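/- arXiv:1905.12461 — 3 statements merged into one kernel-verified Lean document; each statement's English description precedes it below -/
import Mathlib

section
/- For all parameters p ≥ 1, q_1 ≥ 2, q_2 ≥ 1: the split clique-width of S_3(p, q_1; q_2) is at most 3, and the split clique-width of its inverse is at most 3. -/
namespace CWPaper

/-! ## Clique-width expressions -/

/-- Syntax of clique-width expressions.  Labels are natural numbers (`0`-indexed, so a
`k`-expression uses labels `0, …, k-1`). -/
inductive Expr : Type
  | vert : ℕ → Expr
  | union : Expr → Expr → Expr
  | join : ℕ → ℕ → Expr → Expr
  | relabel : ℕ → ℕ → Expr → Expr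

namespace Expr

/-- The vertex set of an expression: one vertex per `vert` leaf. -/
def Verts : Expr → Type
  | vert _ => Unit
  | union a b => Verts a ⊕ Verts b
  | join _ _ a => Verts a
  | relabel _ _ a => Verts a

/-- The label of each vertex after evaluating the expression. -/
def label : (e : Expr) → e.Verts → ℕ
  | vert i, _ => i
  | union a b, v => Sum.elim a.label b.label v
  | join _ _ a, v => a.label v
  | relabel i j a, v => if a.label v = i then j else a.label v

/-- The adjacency relation of the labeled graph built by the expression. -/
def adj : (e : Expr) → e.Verts → e.Verts → Prop
  | vert _, _, _ => False
  | union a b, u, v =>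
      match u, v with
      | .inl u, .inl v => a.adj u v
      | .inr u, .inr v => b.adj u v
      | _, _ => False
  | join i j a, u, v =>
      a.adj u v ∨ (a.label u = i ∧ a.label v = j) ∨ (a.label u = j ∧ a.label v = i)
  | relabel _ _ a, u, v => a.adj u v

/-- `e` is a `k`-expression: all labels used are among `0, …, k-1`, and joins use two
distinct labels. -/
def Valid (k : ℕ) : Expr → Prop
  | vert i => i < k
  | union a b => Valid k a ∧ Valid k b
  | join i j a => i < k ∧ j < k ∧ i ≠ j ∧ Valid k a
  | relabel i j a => i < k ∧ j < k ∧ Valid k a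

/-- The expression `e` constructs the simple graph `G` (the final labels are ignored). -/
def Constructs (e : Expr) {V : Type*} (G : SimpleGraph V) : Prop :=
  ∃ f : e.Verts ≃ V, ∀ u v, G.Adj (f u) (f v) ↔ e.adj u v

/-- The expression `e` constructs the graph `G` *split labeled* with respect to `(A, B)`:
every vertex of `A` ends with the first label (encoded `0`) and every vertex of `B` ends
with the second label (encoded `1`). -/
def ConstructsSplit (e : Expr) {V : Type*} (G : SimpleGraph V) (A B : Set V) : Prop :=
  ∃ f : e.Verts ≃ V, (∀ u v, G.Adj (f u) (f v) ↔ e.adj u v) ∧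
    ∀ u, (f u ∈ A → e.label u = 0) ∧ (f u ∈ B → e.label u = 1)

end Expr

/-- The clique-width of a graph: the least `k` such that some `k`-expression constructs it. -/
noncomputable def cliqueWidth {V : Type*} (G : SimpleGraph V) : ℕ :=
  sInf {k | ∃ e : Expr, e.Valid k ∧ e.Constructs G}

/-- The split clique-width of a splitted graph `(G, A, B)`: the least `k` such that some
`k`-expression constructs `G` split labeled. -/
noncomputable def splitCliqueWidth {V : Type*} (G : SimpleGraph V) (A B : Set V) : ℕ :=
  sInf {k | ∃ e : Expr, e.Valid k ∧ e.ConstructsSplit G A B}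

/-! ## Splitted graphs and compositions -/

/-- `(G, A, B)` is a splitted graph: `A` and `B` partition the vertex set, `A` is a clique
and `B` is an independent set. -/
def IsSplitted {V : Type*} (G : SimpleGraph V) (A B : Set V) : Prop :=
  A ∪ B = Set.univ ∧ Disjoint A B ∧
    (∀ a ∈ A, ∀ b ∈ A, a ≠ b → G.Adj a b) ∧ (∀ a ∈ B, ∀ b ∈ B, ¬ G.Adj a b)

/-- The composition `(G, A, B) ∘ H` of a splitted graph with a graph `H` on a disjoint
vertex set: take the disjoint union and add all edges between `A` and `V(H)`. -/
def comp {U W : Type*} (G : SimpleGraph U) (A : Set U) (H : SimpleGraph W) :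
    SimpleGraph (U ⊕ W) :=
  SimpleGraph.fromRel fun x y =>
    match x, y with
    | .inl a, .inl b => G.Adj a b
    | .inr a, .inr b => H.Adj a b
    | .inl a, .inr _ => a ∈ A
    | .inr _, .inl _ => False

/-- Inverting a splitted graph `(G, A, B)`: remove all edges inside `A` and add all edges
inside `B`.  The inverse splitted graph is `(splitInverse G A B, B, A)`. -/
def splitInverse {V : Type*} (G : SimpleGraph V) (A B : Set V) : SimpleGraph V :=
  SimpleGraph.fromRel fun x y =>
    (G.Adj x y ∧ ¬(x ∈ A ∧ y ∈ A)) ∨ (x ∈ B ∧ y ∈ B)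

/-! ## Unigraphs -/

/-- The multiset of vertex degrees of a finite graph. -/
noncomputable def degreeMultiset (V : Type*) [Fintype V] (G : SimpleGraph V) : Multiset ℕ :=
  (Finset.univ.val : Multiset V).map fun v => (G.neighborSet v).ncard

/-- A finite graph is a unigraph if every finite graph with the same degree multiset is
isomorphic to it. -/
def IsUnigraph {V : Type u} [Fintype V] (G : SimpleGraph V) : Prop :=
  ∀ (W : Type u) (_ : Fintype W) (H : SimpleGraph W),
    degreeMultiset W H = degreeMultiset V G → Nonempty (G ≃g H)

/-! ## Concrete graphs -/

/-- `mK2 m` : the disjoint union of `m` copies of `K₂`. -/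
def mK2 (m : ℕ) : SimpleGraph (Fin m × Fin 2) :=
  SimpleGraph.fromRel fun x y => x.1 = y.1

/-- The star `K_{1,s}`; `none` is the center and the `some i` are the leaves. -/
def starG (s : ℕ) : SimpleGraph (Option (Fin s)) :=
  SimpleGraph.fromRel fun x _ => x = none

/-- `U2 m s` : the disjoint union of `mK₂` and the star `K_{1,s}`. -/
def U2 (m s : ℕ) : SimpleGraph ((Fin m × Fin 2) ⊕ Option (Fin s)) :=
  SimpleGraph.fromRel fun x y =>
    match x, y with
    | .inl a, .inl b => a.1 = b.1
    | .inr a, .inr _ => a = none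
    | _, _ => False

/-- `U3 m` : the disjoint union of `C₄` and `m` triangles with one vertex of each
component identified into the hub `none`.  The vertices `some (Sum.inl i)`, `i = 0, 1, 2`,
are the remaining path of the `C₄` (so the hub is joined to its two endpoints), and
`some (Sum.inr (i, x))` are the two remaining vertices of the `i`-th triangle. -/
def U3 (m : ℕ) : SimpleGraph (Option (Fin 3 ⊕ Fin m × Fin 2)) :=
  SimpleGraph.fromRel fun x y =>
    match x, y with
    | none, some (.inl i) => i ≠ 1
    | none, some (.inr _) => True
    | some (.inl i), some (.inl j) => (i : ℕ) + 1 = (j : ℕ)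
    | some (.inr a), some (.inr b) => a.1 = b.1
    | _, _ => False

/-- A graph is `P₄`-free if no four vertices induce a path on four vertices. -/
def P4Free {V : Type*} (G : SimpleGraph V) : Prop :=
  IsEmpty (SimpleGraph.pathGraph 4 ↪g G)

/-! ## The split unigraphs `S₂`, `S₃`, `S₄` -/

/-- Vertices of `S₂`: the centers `Sum.inl ⟨i, j⟩` (`j`-th center of multiplicity block `i`)
and the leaves `Sum.inr ⟨i, j, x⟩` (`x`-th leaf of the star with center `⟨i, j⟩`). -/
def S2Verts (t : ℕ) (p q : Fin t → ℕ) : Type :=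
  (Σ i : Fin t, Fin (q i)) ⊕ (Σ i : Fin t, Fin (q i) × Fin (p i))

/-- The center of the star a leaf belongs to. -/
def leafCenter {t : ℕ} {p q : Fin t → ℕ} (e : Σ i : Fin t, Fin (q i) × Fin (p i)) :
    Σ i : Fin t, Fin (q i) :=
  ⟨e.1, e.2.1⟩

/-- The split graph `S₂(p₁, q₁; …; p_t, q_t)`: for each `i`, take `q i` disjoint stars
`K_{1, p i}` and join every two centers.  The clique is the set of centers
(`Set.range Sum.inl`) and the independent set is the set of leaves (`Set.range Sum.inr`). -/
def S2 (t : ℕ) (p q : Fin t → ℕ) : SimpleGraph (S2Verts t p q) :=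
  SimpleGraph.fromRel fun x y =>
    match x, y with
    | .inl _, .inl _ => True
    | .inl c, .inr e => leafCenter e = c
    | _, _ => False

/-- The split graph `S₃(p, q₁; q₂)`: add to `S₂(p, q₁; p+1, q₂)` a new independent vertex
`none` joined to exactly the `q₁` centers of the stars `K_{1,p}`. -/
def S3 (p q1 q2 : ℕ) : SimpleGraph (Option (S2Verts 2 ![p, p + 1] ![q1, q2])) :=
  SimpleGraph.fromRel fun x y =>
    match x, y with
    | some a, some b => (S2 2 ![p, p + 1] ![q1, q2]).Adj a b
    | none, some (.inl c) => c.1 = 0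
    | _, _ => False

/-- The clique of the splitted graph `S₃(p, q₁; q₂)` (the star centers). -/
def S3A (p q1 q2 : ℕ) : Set (Option (S2Verts 2 ![p, p + 1] ![q1, q2])) :=
  {x | ∃ c, x = some (Sum.inl c)}

/-- The independent set of the splitted graph `S₃(p, q₁; q₂)` (the leaves and the extra
vertex `none`). -/
def S3B (p q1 q2 : ℕ) : Set (Option (S2Verts 2 ![p, p + 1] ![q1, q2])) :=
  {x | x = none ∨ ∃ e, x = some (Sum.inr e)}

/-- The split graph `S₄(p, q)`: add to `S₃(p, 2; q)` a new clique vertex (the outer `none`)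
joined to every vertex except itself and the special vertex `v` of `S₃` (here `some none`). -/
def S4 (p q : ℕ) : SimpleGraph (Option (Option (S2Verts 2 ![p, p + 1] ![2, q]))) :=
  SimpleGraph.fromRel fun x y =>
    match x, y with
    | some a, some b => (S3 p 2 q).Adj a b
    | none, some (some _) => True
    | _, _ => False

/-- The clique of the splitted graph `S₄(p, q)` (the star centers and the new vertex `u`). -/
def S4A (p q : ℕ) : Set (Option (Option (S2Verts 2 ![p, p + 1] ![2, q]))) :=
  {x | x = none ∨ ∃ c, x = some (some (Sum.inl c))}

/-- The independent set of the splitted graph `S₄(p, q)` (the leaves and the vertex `v`). -/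
def S4B (p q : ℕ) : Set (Option (Option (S2Verts 2 ![p, p + 1] ![2, q]))) :=
  {x | x = some none ∨ ∃ e, x = some (some (Sum.inr e))}

open Classical in
/-- The labeling giving label `a` to the vertices of `K` and label `1` to all others. -/
noncomputable def splitLabel {V : Type*} (a : ℕ) (K : Set V) (x : V) : ℕ :=
  if x ∈ K then a else 1

/-- Some `3`-expression builds the graph that `R` induces on `S`, labeled by `l`
(vacuously so when `S` is empty). -/
def Built {V : Type*} (S : Set V) (R : V → V → Prop) (l : V → ℕ) : Prop :=
  S = ∅ ∨ ∃ e : Expr, e.Valid 3 ∧ ∃ f : e.Verts → V, Function.Injective f ∧ Set.range f = S ∧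
    (∀ u v, R (f u) (f v) ↔ e.adj u v) ∧ ∀ u, e.label u = l (f u)

namespace Built

variable {V : Type*} {S T : Set V} {R R' : V → V → Prop} {l l' : V → ℕ}

theorem congr (h : Built S R l) (hR : ∀ u ∈ S, ∀ v ∈ S, (R' u v ↔ R u v))
    (hl : ∀ u ∈ S, l' u = l u) : Built S R' l' := by
  rcases h with h | ⟨e, he, f, hf, rfl, hadj, hlab⟩
  · exact Or.inl h
  · refine Or.inr ⟨e, he, f, hf, rfl, fun u v => ?_, fun u => ?_⟩
    · rw [hR _ ⟨u, rfl⟩ _ ⟨v, rfl⟩, hadj]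
    · rw [hl _ ⟨u, rfl⟩, hlab]

theorem singleton (x : V) (hx : ¬ R x x) (hl : l x < 3) : Built {x} R l := by
  refine Or.inr ⟨.vert (l x), hl, fun _ => x, fun _ _ _ => rfl, ?_, fun _ _ => ?_, fun _ => rfl⟩
  · ext y
    exact ⟨fun ⟨_, h⟩ => h.symm, fun h => ⟨(), Eq.symm h⟩⟩
  · exact iff_of_false hx id

theorem join {i j : ℕ} (h : Built S R l) (hi : i < 3) (hj : j < 3) (hij : i ≠ j) :
    Built S (fun u v => R u v ∨ (l u = i ∧ l v = j) ∨ (l u = j ∧ l v = i)) l := by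
  rcases h with h | ⟨e, he, f, hf, hS, hadj, hlab⟩
  · exact Or.inl h
  · refine Or.inr ⟨.join i j e, ⟨hi, hj, hij, he⟩, f, hf, hS, fun u v => ?_, hlab⟩
    have h : ∀ u v : e.Verts, (R (f u) (f v) ∨ (l (f u) = i ∧ l (f v) = j) ∨
        (l (f u) = j ∧ l (f v) = i)) ↔ (e.adj u v ∨ (e.label u = i ∧ e.label v = j) ∨
          (e.label u = j ∧ e.label v = i)) := fun u v => by rw [hadj, hlab, hlab]
    exact h u v

theorem relabel {i j : ℕ} (h : Built S R l) (hi : i < 3) (hj : j < 3) :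
    Built S R (fun u => if l u = i then j else l u) := by
  rcases h with h | ⟨e, he, f, hf, hS, hadj, hlab⟩
  · exact Or.inl h
  · refine Or.inr ⟨.relabel i j e, ⟨hi, hj, he⟩, f, hf, hS, hadj, fun u => ?_⟩
    have h : ∀ u : e.Verts, (if e.label u = i then j else e.label u) =
        if l (f u) = i then j else l (f u) := fun u => by rw [hlab]
    exact h u

open Classical in
theorem union (hS : Built S R l) (hT : Built T R l') (hST : Disjoint S T) :
    Built (S ∪ T) (fun u v => R u v ∧ (u ∈ S ↔ v ∈ S))
      (fun u => if u ∈ S then l u else l' u) := by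
  have hdisj : ∀ u ∈ T, u ∉ S := fun u hu hu' => Set.disjoint_left.1 hST hu' hu
  rcases hS with rfl | hS'
  · rw [Set.empty_union]
    exact hT.congr (by simp) (by simp)
  rcases hT with rfl | hT'
  · rw [Set.union_empty]
    exact Built.congr (Or.inr hS') (fun u hu v hv => by simp [hu, hv]) (fun u hu => by simp [hu])
  obtain ⟨e, he, f, hf, rfl, hadj, hlab⟩ := hS'
  obtain ⟨e', he', f', hf', rfl, hadj', hlab'⟩ := hT'
  have hn : ∀ v, f' v ∉ Set.range f := fun v => hdisj _ ⟨v, rfl⟩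
  have hm : ∀ v, f v ∈ Set.range f := fun v => ⟨v, rfl⟩
  refine Or.inr ⟨.union e e', ⟨he, he'⟩, Sum.elim f f', ?_, Set.Sum.elim_range f f', ?_, ?_⟩
  · exact hf.sumElim hf' fun a b hab => hn b (hab ▸ hm a)
  · rintro (u | u) (v | v)
    · exact (and_iff_left (iff_of_true (hm u) (hm v))).trans (hadj u v)
    · exact iff_of_false (fun h => hn v (h.2.1 (hm u))) id
    · exact iff_of_false (fun h => hn u (h.2.2 (hm v))) id
    · exact (and_iff_left (iff_of_false (hn u) (hn v))).trans (hadj' u v)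
  · rintro (u | u)
    · exact (hlab u).trans (if_pos (hm u)).symm
    · exact (hlab' u).trans (if_neg (hn u)).symm

variable {G : SimpleGraph V} {K : Set V}

/-- Two labeled pieces whose only cross edges are those of the clique `K` can be merged. -/
theorem attach (hS : Built S G.Adj (splitLabel 0 K)) (hT : Built T G.Adj (splitLabel 2 K))
    (hST : Disjoint S T) (hc : ∀ s ∈ S, ∀ t ∈ T, (G.Adj s t ↔ s ∈ K ∧ t ∈ K)) :
    Built (S ∪ T) G.Adj (splitLabel 0 K) := by
  classical
  have hdisj : ∀ u ∈ T, u ∉ S := fun u hu hu' => Set.disjoint_left.1 hST hu' hu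
  refine (((hS.union hT hST).join (i := 0) (j := 2) (by omega) (by omega) (by omega)).relabel
    (i := 2) (j := 0) (by omega) (by omega)).congr ?_ ?_
  · rintro u (hu | hu) v (hv | hv)
    · simp [hu, hv, splitLabel]; grind
    · simp [hu, hdisj v hv, splitLabel, hc u hu v hv]; grind
    · rw [G.adj_comm]
      simp [hv, hdisj u hu, splitLabel, hc v hv u hu]; grind
    · simp [hdisj v hv, hdisj u hu, splitLabel]; grind
  · rintro u (hu | hu)
    · simp [hu, splitLabel]; grind
    · simp [hdisj u hu, splitLabel]; grind

/-- Adding an independent vertex adjacent to exactly the vertices of `K`. -/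
theorem insert_of_notMem {a b : ℕ} {x : V} (h : Built S G.Adj (splitLabel a K)) (ha : a < 3)
    (hb : b < 3) (hab : a ≠ b) (hb1 : b ≠ 1) (hx : x ∉ S) (hxK : x ∉ K)
    (hc : ∀ s ∈ S, (G.Adj s x ↔ s ∈ K)) (ha1 : a ≠ 1) :
    Built (S ∪ {x}) G.Adj (splitLabel a K) := by
  classical
  refine (((h.union (singleton (l := fun _ => b) x G.irrefl hb)
    (Set.disjoint_singleton_right.2 hx)).join ha hb hab).relabel (i := b) (j := 1)
    hb (by omega)).congr ?_ ?_
  · rintro u (hu | rfl) v (hv | rfl)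
    · simp [hu, hv, splitLabel]; grind
    · simp [hu, hx, splitLabel, hc u hu]; grind
    · rw [G.adj_comm]
      simp [hv, hx, splitLabel, hc v hv]; grind
    · simp [hx]; grind
  · rintro u (hu | rfl)
    · simp [hu, splitLabel]; grind
    · simp [hx, splitLabel, hxK]

/-- Adding a clique vertex adjacent to everything built so far. -/
theorem insert_of_mem {a b : ℕ} {x : V} (h : Built S G.Adj (splitLabel a K)) (ha : a < 3)
    (hb : b < 3) (hab : a ≠ b) (hb1 : b ≠ 1) (hx : x ∉ S) (hxK : x ∈ K)
    (hc : ∀ s ∈ S, G.Adj s x) :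
    Built (S ∪ {x}) G.Adj (splitLabel a K) := by
  classical
  refine ((((h.union (singleton (l := fun _ => b) x G.irrefl hb)
    (Set.disjoint_singleton_right.2 hx)).join ha hb hab).join (i := 1) (j := b) (by omega) hb
    hb1.symm).relabel (i := b) (j := a) hb ha).congr ?_ ?_
  · rintro u (hu | rfl) v (hv | rfl)
    · simp [hu, hv, splitLabel]; grind
    · simp [hu, hx, splitLabel, hc u hu]; grind
    · rw [G.adj_comm]
      simp [hv, hx, splitLabel, hc v hv]; grind
    · simp [hx]; grind
  · rintro u (hu | rfl)
    · simp [hu, splitLabel]; grind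
    · simp [hx, splitLabel, hxK]

theorem attach_iUnion {C : Type*} {star : C → Set V} (F : Finset C)
    (hS : Built S G.Adj (splitLabel 0 K))
    (hstar : ∀ c ∈ F, Built (star c) G.Adj (splitLabel 2 K))
    (hdisj : ∀ c ∈ F, ∀ d ∈ F, c ≠ d → Disjoint (star c) (star d))
    (hcross : ∀ c ∈ F, ∀ d ∈ F, c ≠ d →
      ∀ x ∈ star c, ∀ y ∈ star d, (G.Adj x y ↔ x ∈ K ∧ y ∈ K))
    (hSdisj : ∀ c ∈ F, Disjoint S (star c))
    (hScross : ∀ c ∈ F, ∀ x ∈ S, ∀ y ∈ star c, (G.Adj x y ↔ x ∈ K ∧ y ∈ K)) :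
    Built (S ∪ ⋃ c ∈ F, star c) G.Adj (splitLabel 0 K) := by
  classical
  induction F using Finset.induction_on with
  | empty => simpa using hS
  | insert c F hc ih =>
    have hne : ∀ d ∈ F, d ≠ c := fun d hd h => hc (h ▸ hd)
    rw [Finset.set_biUnion_insert, Set.union_comm (star c), ← Set.union_assoc]
    refine attach (ih ?_ ?_ ?_ ?_ ?_) (hstar c (Finset.mem_insert_self c F)) ?_ ?_
    · exact fun d hd => hstar d (Finset.mem_insert_of_mem hd)
    · exact fun d hd d' hd' =>
        hdisj d (Finset.mem_insert_of_mem hd) d' (Finset.mem_insert_of_mem hd')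
    · exact fun d hd d' hd' =>
        hcross d (Finset.mem_insert_of_mem hd) d' (Finset.mem_insert_of_mem hd')
    · exact fun d hd => hSdisj d (Finset.mem_insert_of_mem hd)
    · exact fun d hd => hScross d (Finset.mem_insert_of_mem hd)
    · rw [Set.disjoint_union_left, Set.disjoint_iUnion₂_left]
      exact ⟨hSdisj c (Finset.mem_insert_self c F), fun d hd =>
        hdisj d (Finset.mem_insert_of_mem hd) c (Finset.mem_insert_self c F) (hne d hd)⟩
    · rintro x (hx | hx) y hy
      · exact hScross c (Finset.mem_insert_self c F) x hx y hy
      · obtain ⟨d, hd, hx⟩ := Set.mem_iUnion₂.1 hx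
        exact hcross d (Finset.mem_insert_of_mem hd) c (Finset.mem_insert_self c F) (hne d hd)
          x hx y hy

/-- A star with center in the clique side `K` and leaves outside of it. -/
theorem star_of_mem {x : V} {L : Finset V} (hx : x ∈ K) (hL : ∀ y ∈ L, y ∉ K)
    (hxL : ∀ y ∈ L, G.Adj x y) (hLL : ∀ y ∈ L, ∀ z ∈ L, ¬ G.Adj y z) :
    Built ({x} ∪ (L : Set V)) G.Adj (splitLabel 2 K) := by
  classical
  induction L using Finset.induction_on with
  | empty =>
    simpa using singleton (R := G.Adj) (l := splitLabel 2 K) x G.irrefl (by simp [splitLabel, hx])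
  | insert y L hy ih =>
    rw [Finset.coe_insert, Set.insert_eq, Set.union_comm {y}, ← Set.union_assoc]
    refine insert_of_notMem (b := 0) (ih ?_ ?_ ?_) (by omega) (by omega) (by omega) (by omega)
      ?_ (hL y (Finset.mem_insert_self y L)) ?_ (by omega) <;> grind

/-- A clique of leaves inside `K`, all adjacent to one center outside of `K`. -/
theorem star_of_notMem {x : V} {L : Finset V} (hx : x ∉ K) (hL : ∀ y ∈ L, y ∈ K)
    (hxL : ∀ y ∈ L, G.Adj x y) (hLL : ∀ y ∈ L, ∀ z ∈ L, y ≠ z → G.Adj y z) :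
    Built ({x} ∪ (L : Set V)) G.Adj (splitLabel 2 K) := by
  classical
  induction L using Finset.induction_on with
  | empty =>
    simpa using singleton (R := G.Adj) (l := splitLabel 2 K) x G.irrefl (by simp [splitLabel, hx])
  | insert y L hy ih =>
    rw [Finset.coe_insert, Set.insert_eq, Set.union_comm {y}, ← Set.union_assoc]
    refine insert_of_mem (b := 0) (ih ?_ ?_ ?_) (by omega) (by omega) (by omega) (by omega)
      ?_ (hL y (Finset.mem_insert_self y L)) ?_ <;> grind

theorem splitCliqueWidth_le [Nonempty V] {A B : Set V}
    (h : Built Set.univ G.Adj (splitLabel 0 A)) (hAB : Disjoint A B) :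
    splitCliqueWidth G A B ≤ 3 := by
  rcases h with h | ⟨e, he, f, hf, hS, hadj, hlab⟩
  · exact absurd h Set.univ_nonempty.ne_empty
  · refine Nat.sInf_le ⟨e, he, Equiv.ofBijective f ⟨hf, Set.range_eq_univ.1 hS⟩, hadj, fun u => ?_⟩
    simp only [hlab, splitLabel]
    exact ⟨fun h => if_pos h, fun h => if_neg fun h' => Set.disjoint_left.1 hAB h' h⟩

end Built

namespace S3

variable {p q1 q2 : ℕ}

/-- The clique vertex of `S3 p q1 q2` that is the center of the star `c`. -/
def center (c : Σ i : Fin 2, Fin ((![q1, q2] : Fin 2 → ℕ) i)) :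
    Option (S2Verts 2 ![p, p + 1] ![q1, q2]) :=
  some (.inl c)

/-- The independent vertex of `S3 p q1 q2` that is the leaf `e` of a star. -/
def leaf (e : Σ i : Fin 2, Fin ((![q1, q2] : Fin 2 → ℕ) i) × Fin ((![p, p + 1] : Fin 2 → ℕ) i)) :
    Option (S2Verts 2 ![p, p + 1] ![q1, q2]) :=
  some (.inr e)

/-- The vertices of the star `c` of `S3 p q1 q2`. -/
def star (c : Σ i : Fin 2, Fin ((![q1, q2] : Fin 2 → ℕ) i)) :
    Set (Option (S2Verts 2 ![p, p + 1] ![q1, q2])) :=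
  {center c} ∪ leaf '' {e | leafCenter e = c}

theorem cases (x : Option (S2Verts 2 ![p, p + 1] ![q1, q2])) :
    x = none ∨ (∃ c, x = center c) ∨ ∃ e, x = leaf e := by
  rcases x with _ | c | e
  exacts [Or.inl rfl, Or.inr (Or.inl ⟨c, rfl⟩), Or.inr (Or.inr ⟨e, rfl⟩)]

variable {c d : Σ i : Fin 2, Fin ((![q1, q2] : Fin 2 → ℕ) i)}
  {e e' : Σ i : Fin 2, Fin ((![q1, q2] : Fin 2 → ℕ) i) × Fin ((![p, p + 1] : Fin 2 → ℕ) i)}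

@[simp] theorem center_ne_none : (center c : Option (S2Verts 2 ![p, p + 1] ![q1, q2])) ≠ none :=
  Option.some_ne_none _

@[simp] theorem leaf_ne_none : leaf e ≠ none := Option.some_ne_none _

@[simp] theorem none_ne_center : none ≠ (center c : Option (S2Verts 2 ![p, p + 1] ![q1, q2])) :=
  center_ne_none.symm

@[simp] theorem none_ne_leaf : none ≠ leaf e := leaf_ne_none.symm

@[simp] theorem center_inj :
    (center c : Option (S2Verts 2 ![p, p + 1] ![q1, q2])) = center d ↔ c = d :=
  (Option.some_inj).trans Sum.inl_injective.eq_iff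

@[simp] theorem leaf_inj : leaf e = leaf e' ↔ e = e' :=
  (Option.some_inj).trans Sum.inr_injective.eq_iff

@[simp] theorem center_ne_leaf : center c ≠ leaf e :=
  fun h => Sum.inl_ne_inr (Option.some_inj.1 h)

@[simp] theorem leaf_ne_center : leaf e ≠ center c := center_ne_leaf.symm

@[simp] theorem center_mem_S3A : center c ∈ S3A p q1 q2 := ⟨c, rfl⟩

@[simp] theorem leaf_notMem_S3A : leaf e ∉ S3A p q1 q2 := fun ⟨_, h⟩ => leaf_ne_center h

@[simp] theorem none_notMem_S3A : none ∉ S3A p q1 q2 := fun ⟨_, h⟩ => none_ne_center h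

theorem mem_S3B_iff {x : Option (S2Verts 2 ![p, p + 1] ![q1, q2])} :
    x ∈ S3B p q1 q2 ↔ x ∉ S3A p q1 q2 := by
  rcases cases x with rfl | ⟨c, rfl⟩ | ⟨e, rfl⟩
  · exact iff_of_true (Or.inl rfl) none_notMem_S3A
  · exact iff_of_false (fun h => h.elim center_ne_none fun ⟨_, h⟩ => center_ne_leaf h)
      (not_not.2 center_mem_S3A)
  · exact iff_of_true (Or.inr ⟨e, rfl⟩) leaf_notMem_S3A

@[simp] theorem adj_center_center : (S3 p q1 q2).Adj (center c) (center d) ↔ c ≠ d := by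
  have h : (S2 2 ![p, p + 1] ![q1, q2]).Adj (.inl c) (.inl d) ↔ c ≠ d := by
    refine (SimpleGraph.fromRel_adj _ _ _).trans ?_
    exact ⟨fun h h' => h.1 (congrArg Sum.inl h'), fun h =>
      ⟨fun h' => h (Sum.inl_injective h'), Or.inl trivial⟩⟩
  rw [S3, SimpleGraph.fromRel_adj]
  refine ⟨fun h' => h.1 (h'.2.elim id fun h => h.symm), fun h' => ⟨?_, Or.inl (h.2 h')⟩⟩
  simpa using h'

@[simp] theorem adj_center_leaf :
    (S3 p q1 q2).Adj (center c) (leaf e) ↔ leafCenter e = c := by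
  have h : (S2 2 ![p, p + 1] ![q1, q2]).Adj (.inl c) (.inr e) ↔ leafCenter e = c := by
    refine (SimpleGraph.fromRel_adj _ _ _).trans ?_
    exact ⟨fun h => h.2.elim id False.elim, fun h => ⟨Sum.inl_ne_inr, Or.inl h⟩⟩
  rw [S3, SimpleGraph.fromRel_adj]
  exact ⟨fun h' => h.1 (h'.2.elim id fun h => h.symm), fun h' =>
    ⟨center_ne_leaf, Or.inl (h.2 h')⟩⟩

@[simp] theorem not_adj_leaf_leaf : ¬ (S3 p q1 q2).Adj (leaf e) (leaf e') := by
  have h : ∀ e e', ¬ (S2 2 ![p, p + 1] ![q1, q2]).Adj (.inr e) (.inr e') := fun e e' h =>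
    ((SimpleGraph.fromRel_adj _ _ _).1 h).2.elim id id
  rw [S3, SimpleGraph.fromRel_adj]
  exact fun h' => h'.2.elim (h e e') (h e' e)

@[simp] theorem adj_center_none : (S3 p q1 q2).Adj (center c) none ↔ c.1 = 0 := by
  rw [S3, SimpleGraph.fromRel_adj]
  exact ⟨fun h => h.2.elim False.elim id, fun h => ⟨center_ne_none, Or.inr h⟩⟩

@[simp] theorem not_adj_leaf_none : ¬ (S3 p q1 q2).Adj (leaf e) none := by
  rw [S3, SimpleGraph.fromRel_adj]
  exact fun h => h.2.elim id id

@[simp] theorem adj_leaf_center :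
    (S3 p q1 q2).Adj (leaf e) (center c) ↔ leafCenter e = c := by
  rw [SimpleGraph.adj_comm, adj_center_leaf]

@[simp] theorem adj_none_center : (S3 p q1 q2).Adj none (center c) ↔ c.1 = 0 := by
  rw [SimpleGraph.adj_comm, adj_center_none]

@[simp] theorem not_adj_none_leaf : ¬ (S3 p q1 q2).Adj none (leaf e) := by
  rw [SimpleGraph.adj_comm]
  exact not_adj_leaf_none

theorem inverse_adj {x y : Option (S2Verts 2 ![p, p + 1] ![q1, q2])} :
    (splitInverse (S3 p q1 q2) (S3A p q1 q2) (S3B p q1 q2)).Adj x y ↔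
      x ≠ y ∧ (((S3 p q1 q2).Adj x y ∧ ¬ (x ∈ S3A p q1 q2 ∧ y ∈ S3A p q1 q2)) ∨
        (x ∉ S3A p q1 q2 ∧ y ∉ S3A p q1 q2)) := by
  rw [splitInverse, SimpleGraph.fromRel_adj, (S3 p q1 q2).adj_comm y x]
  simp only [mem_S3B_iff]
  tauto

/-- A graph on the vertices of `S3 p q1 q2` whose stars can be built, with only clique edges
between different stars, can be built by treating the stars of the first kind, then the special
vertex, and then the stars of the second kind. -/
theorem built_univ {G : SimpleGraph (Option (S2Verts 2 ![p, p + 1] ![q1, q2]))}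
    {K : Set (Option (S2Verts 2 ![p, p + 1] ![q1, q2]))}
    (hstar : ∀ c, Built (star c) G.Adj (splitLabel 2 K))
    (hcross : ∀ c d, c ≠ d → ∀ x ∈ star c, ∀ y ∈ star d, (G.Adj x y ↔ x ∈ K ∧ y ∈ K))
    (hnone : ∀ c : Σ i : Fin 2, Fin ((![q1, q2] : Fin 2 → ℕ) i), c.1 ≠ 0 → ∀ x ∈ star c,
      (G.Adj none x ↔ none ∈ K ∧ x ∈ K))
    (hins : ∀ S : Set (Option (S2Verts 2 ![p, p + 1] ![q1, q2])),
      (∀ x ∈ S, ∃ c : Σ i : Fin 2, Fin ((![q1, q2] : Fin 2 → ℕ) i), c.1 = 0 ∧ x ∈ star c) →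
      Built S G.Adj (splitLabel 0 K) → Built (S ∪ {none}) G.Adj (splitLabel 0 K)) :
    Built Set.univ G.Adj (splitLabel 0 K) := by
  classical
  have hdisj : ∀ c d : Σ i : Fin 2, Fin ((![q1, q2] : Fin 2 → ℕ) i), c ≠ d →
      Disjoint (star c : Set (Option (S2Verts 2 ![p, p + 1] ![q1, q2]))) (star d) := by
    intro c d hcd
    rw [Set.disjoint_left]
    rintro x (rfl | ⟨e, rfl, rfl⟩) (h | ⟨e', rfl, h⟩)
    · exact hcd (center_inj.1 h)
    · exact leaf_ne_center h
    · exact leaf_ne_center h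
    · exact hcd (congrArg leafCenter (leaf_inj.1 h).symm)
  have hnone' : ∀ c : Σ i : Fin 2, Fin ((![q1, q2] : Fin 2 → ℕ) i),
      (none : Option (S2Verts 2 ![p, p + 1] ![q1, q2])) ∉ star c := by
    rintro c (h | ⟨e, -, h⟩)
    · exact none_ne_center h
    · exact leaf_ne_none h
  let F : Finset (Σ i : Fin 2, Fin ((![q1, q2] : Fin 2 → ℕ) i)) := Finset.univ.filter (·.1 = 0)
  let F' : Finset (Σ i : Fin 2, Fin ((![q1, q2] : Fin 2 → ℕ) i)) := Finset.univ.filter (·.1 ≠ 0)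
  have hF : ∀ c, c ∈ F ↔ c.1 = 0 := fun c => by simp [F]
  have hF' : ∀ c, c ∈ F' ↔ c.1 ≠ 0 := fun c => by simp [F']
  have h1 : Built (∅ ∪ ⋃ c ∈ F, star c) G.Adj (splitLabel 0 K) :=
    Built.attach_iUnion F (Or.inl rfl) (fun c _ => hstar c) (fun c _ d _ => hdisj c d)
      (fun c _ d _ => hcross c d) (by simp) (by simp)
  rw [Set.empty_union] at h1
  have h2 := hins _ (fun x hx => by
    obtain ⟨c, hc, hx⟩ := Set.mem_iUnion₂.1 hx
    exact ⟨c, (hF c).1 hc, hx⟩) h1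
  have hne : ∀ c ∈ F, ∀ d ∈ F', c ≠ d := fun c hc d hd h =>
    (hF' d).1 hd (h ▸ (hF c).1 hc)
  have h3 := Built.attach_iUnion F' h2 (fun c _ => hstar c) (fun c _ d _ => hdisj c d)
    (fun c _ d _ => hcross c d) (fun c hc => by
      rw [Set.disjoint_union_left, Set.disjoint_iUnion₂_left, Set.disjoint_singleton_left]
      exact ⟨fun d hd => hdisj d c (hne d hd c hc), hnone' c⟩) (by
      rintro c hc x (hx | rfl) y hy
      · obtain ⟨d, hd, hx⟩ := Set.mem_iUnion₂.1 hx
        exact hcross d c (hne d hd c hc) x hx y hy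
      · exact hnone c ((hF' c).1 hc) y hy)
  have hmem : ∀ c, ∀ x ∈ star c, x ∈ ((⋃ c ∈ F, star c) ∪ {none}) ∪
      ⋃ c ∈ F', (star c : Set (Option (S2Verts 2 ![p, p + 1] ![q1, q2]))) := by
    intro c x hx
    by_cases hc : c.1 = 0
    · exact Or.inl (Or.inl (Set.mem_iUnion₂.2 ⟨c, (hF c).2 hc, hx⟩))
    · exact Or.inr (Set.mem_iUnion₂.2 ⟨c, (hF' c).2 hc, hx⟩)
  convert h3
  refine (Set.eq_univ_of_forall fun x => ?_).symm
  rcases cases x with rfl | ⟨c, rfl⟩ | ⟨e, rfl⟩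
  · exact Or.inl (Or.inr rfl)
  · exact hmem c _ (Or.inl rfl)
  · exact hmem (leafCenter e) _ (Or.inr ⟨e, rfl, rfl⟩)

theorem star_eq (c : Σ i : Fin 2, Fin ((![q1, q2] : Fin 2 → ℕ) i)) :
    ∃ L : Finset (Option (S2Verts 2 ![p, p + 1] ![q1, q2])),
      star c = {center c} ∪ (L : Set (Option (S2Verts 2 ![p, p + 1] ![q1, q2]))) ∧
      ∀ x ∈ L, ∃ e, x = leaf e ∧ leafCenter e = c := by
  have hfin : (leaf '' {e | leafCenter e = c} :
    Set (Option (S2Verts 2 ![p, p + 1] ![q1, q2]))).Finite := Set.toFinite _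
  refine ⟨hfin.toFinset, by rw [hfin.coe_toFinset, star], fun x hx => ?_⟩
  obtain ⟨e, he, rfl⟩ := hfin.mem_toFinset.1 hx
  exact ⟨e, rfl, he⟩

theorem none_notMem {S : Set (Option (S2Verts 2 ![p, p + 1] ![q1, q2]))}
    (hS : ∀ x ∈ S, ∃ c : Σ i : Fin 2, Fin ((![q1, q2] : Fin 2 → ℕ) i), c.1 = 0 ∧ x ∈ star c) :
    none ∉ S := by
  intro h
  obtain ⟨c, -, h | ⟨e, -, h⟩⟩ := hS _ h
  · exact none_ne_center h
  · exact leaf_ne_none h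

theorem built : Built Set.univ (S3 p q1 q2).Adj (splitLabel 0 (S3A p q1 q2)) := by
  refine built_univ (fun c => ?_) ?_ ?_ fun S hS h => ?_
  · obtain ⟨L, hL, hleaf⟩ := star_eq (p := p) c
    rw [hL]
    refine Built.star_of_mem center_mem_S3A ?_ ?_ ?_
    · intro y hy
      obtain ⟨e, rfl, -⟩ := hleaf y hy
      exact leaf_notMem_S3A
    · intro y hy
      obtain ⟨e, rfl, he⟩ := hleaf y hy
      exact adj_center_leaf.2 he
    · intro y hy z hz
      obtain ⟨e, rfl, -⟩ := hleaf y hy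
      obtain ⟨e', rfl, -⟩ := hleaf z hz
      exact not_adj_leaf_leaf
  · rintro c d hcd x (rfl | ⟨e, rfl, rfl⟩) y (rfl | ⟨e', rfl, rfl⟩)
    · simpa using hcd
    · simpa using hcd.symm
    · simpa using hcd
    · simp
  · rintro c hc x (rfl | ⟨e, rfl, rfl⟩)
    · simpa using hc
    · simp
  · refine h.insert_of_notMem (b := 2) (by omega) (by omega) (by omega) (by omega)
      (none_notMem hS) none_notMem_S3A (fun s hs => ?_) (by omega)
    obtain ⟨c, hc, rfl | ⟨e, rfl, rfl⟩⟩ := hS s hs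
    · simpa using hc
    · simp

theorem built_inverse : Built Set.univ
    (splitInverse (S3 p q1 q2) (S3A p q1 q2) (S3B p q1 q2)).Adj
      (splitLabel 0 (S3B p q1 q2)) := by
  refine built_univ (fun c => ?_) ?_ ?_ fun S hS h => ?_
  · obtain ⟨L, hL, hleaf⟩ := star_eq (p := p) c
    rw [hL]
    refine Built.star_of_notMem (by simp [mem_S3B_iff]) ?_ ?_ ?_
    · intro y hy
      obtain ⟨e, rfl, -⟩ := hleaf y hy
      simp [mem_S3B_iff]
    · intro y hy
      obtain ⟨e, rfl, he⟩ := hleaf y hy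
      simp [inverse_adj, he]
    · intro y hy z hz hyz
      obtain ⟨e, rfl, -⟩ := hleaf y hy
      obtain ⟨e', rfl, -⟩ := hleaf z hz
      simpa [inverse_adj] using hyz
  · rintro c d hcd x (rfl | ⟨e, rfl, rfl⟩) y (rfl | ⟨e', rfl, rfl⟩)
    · simp [inverse_adj, mem_S3B_iff]
    · simpa [inverse_adj, mem_S3B_iff] using hcd.symm
    · simpa [inverse_adj, mem_S3B_iff] using hcd
    · have hne : e ≠ e' := fun h => hcd (congrArg leafCenter h)
      simpa [inverse_adj, mem_S3B_iff] using hne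
  · rintro c hc x (rfl | ⟨e, rfl, rfl⟩)
    · simpa [inverse_adj, mem_S3B_iff] using hc
    · simp [inverse_adj, mem_S3B_iff]
  · refine h.insert_of_mem (b := 2) (by omega) (by omega) (by omega) (by omega)
      (none_notMem hS) (mem_S3B_iff.2 none_notMem_S3A) fun s hs => ?_
    obtain ⟨c, hc, rfl | ⟨e, rfl, rfl⟩⟩ := hS s hs
    · simpa [inverse_adj] using hc
    · simp [inverse_adj]

end S3

theorem stmt17 (p q1 q2 : ℕ) (hp : 1 ≤ p) (hq1 : 2 ≤ q1) (hq2 : 1 ≤ q2) :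
    splitCliqueWidth (S3 p q1 q2) (S3A p q1 q2) (S3B p q1 q2) ≤ 3 ∧
    splitCliqueWidth (splitInverse (S3 p q1 q2) (S3A p q1 q2) (S3B p q1 q2))
      (S3B p q1 q2) (S3A p q1 q2) ≤ 3 := by
  have hAB : Disjoint (S3A p q1 q2) (S3B p q1 q2) :=
    Set.disjoint_left.2 fun _ h h' => S3.mem_S3B_iff.1 h' h
  exact ⟨S3.built.splitCliqueWidth_le hAB, S3.built_inverse.splitCliqueWidth_le hAB.symm⟩

end CWPaper
end

section
/- For all parameters p ≥ 1, q_1 ≥ 2, q_2 ≥ 1: the split clique-width of the complement of S_3(p, q_1; q_2) is at most 4, and the split clique-width of the inverse-complement of S_3(p, q_1; q_2) is at most 4. -/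
namespace CWPaper

open Set

/-- `e` is a `k`-expression for the restriction of `r` to `S`, with final labels given by `L`. -/
def Builds {V : Type*} (k : ℕ) (r : V → V → Prop) (L : V → ℕ) (S : Set V) : Prop :=
  ∃ e : Expr, e.Valid k ∧ ∃ f : e.Verts → V, Function.Injective f ∧ range f = S ∧
    (∀ u v, r (f u) (f v) ↔ e.adj u v) ∧ ∀ u, e.label u = L (f u)

namespace Builds

variable {V : Type*} {k : ℕ} {r r' : V → V → Prop} {L L' : V → ℕ} {S T : Set V}

theorem congr (h : Builds k r L S) (hr : ∀ x ∈ S, ∀ y ∈ S, r' x y ↔ r x y)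
    (hL : ∀ x ∈ S, L' x = L x) : Builds k r' L' S := by
  obtain ⟨e, he, f, hf, rfl, hadj, hlab⟩ := h
  refine ⟨e, he, f, hf, rfl, fun u v => ?_, fun u => ?_⟩
  · rw [hr _ (mem_range_self u) _ (mem_range_self v), hadj]
  · rw [hL _ (mem_range_self u), hlab]

theorem singleton (x : V) (hx : L x < k) (hr : ¬ r x x) : Builds k r L {x} :=
  ⟨.vert (L x), hx, fun _ => x, fun _ _ _ => rfl, @range_const _ _ ⟨()⟩ x,
    fun _ _ => iff_of_false hr id, fun _ => rfl⟩

theorem relabel (h : Builds k r L S) {i j : ℕ} (hi : i < k) (hj : j < k) :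
    Builds k r (fun x => if L x = i then j else L x) S := by
  obtain ⟨e, he, f, hf, hS, hadj, hlab⟩ := h
  refine ⟨.relabel i j e, ⟨hi, hj, he⟩, f, hf, hS, hadj, fun u => ?_⟩
  exact congrArg (fun m => if m = i then j else m) (hlab u)

theorem join (h : Builds k r L S) {i j : ℕ} (hi : i < k) (hj : j < k) (hij : i ≠ j) (P : Prop) :
    Builds k (fun x y => r x y ∨ P ∧ (L x = i ∧ L y = j ∨ L x = j ∧ L y = i)) L S := by
  by_cases hP : P
  · obtain ⟨e, he, f, hf, hS, hadj, hlab⟩ := h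
    have key : ∀ u v : e.Verts,
        (r (f u) (f v) ∨ P ∧ (L (f u) = i ∧ L (f v) = j ∨ L (f u) = j ∧ L (f v) = i)) ↔
          e.adj u v ∨ (e.label u = i ∧ e.label v = j) ∨ (e.label u = j ∧ e.label v = i) :=
      fun u v => by simp only [hP, true_and, hadj, hlab]
    exact ⟨.join i j e, ⟨hi, hj, hij, he⟩, f, hf, hS, key, hlab⟩
  · exact h.congr (by simp [hP]) (by simp)

theorem union (hS : Builds k r L S) (hT : Builds k r L T) (hST : Disjoint S T)
    (hr : ∀ x ∈ S, ∀ y ∈ T, ¬ r x y ∧ ¬ r y x) : Builds k r L (S ∪ T) := by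
  obtain ⟨a, ha, f, hf, rfl, hfa, hfl⟩ := hS
  obtain ⟨b, hb, g, hg, rfl, hga, hgl⟩ := hT
  refine ⟨.union a b, ⟨ha, hb⟩, Sum.elim f g,
    hf.sumElim hg fun u v => hST.ne_of_mem (mem_range_self u) (mem_range_self v),
    Sum.elim_range f g, ?_, ?_⟩
  · rintro (u | u) (v | v)
    · exact hfa u v
    · exact iff_of_false (hr _ (mem_range_self u) _ (mem_range_self v)).1 id
    · exact iff_of_false (hr _ (mem_range_self v) _ (mem_range_self u)).2 id
    · exact hga u v
  · rintro (u | u)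
    · exact hfl u
    · exact hgl u

/-- Two graphs with labels `0, 1` can be combined using four labels whenever the cross adjacency
is determined by the labels. -/
theorem combine {G : SimpleGraph V} (hL : ∀ x, L x < 2) (J : ℕ → ℕ → Prop)
    (hS : Builds 4 G.Adj L S) (hT : Builds 4 G.Adj L T) (hST : Disjoint S T)
    (hJ : ∀ x ∈ S, ∀ y ∈ T, G.Adj x y ↔ J (L x) (L y)) : Builds 4 G.Adj L (S ∪ T) := by
  classical
  have hTS : ∀ x ∈ T, x ∉ S := fun x hx hx' => hST.ne_of_mem hx' hx rfl
  let r : V → V → Prop := fun x y => G.Adj x y ∧ (x ∈ S ↔ y ∈ S)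
  let M : V → ℕ := fun x => if x ∈ S then L x else L x + 2
  have hMS : Builds 4 r M S :=
    hS.congr (fun x hx y hy => by simp [r, hx, hy]) (fun x hx => by simp [M, hx])
  have hMT : Builds 4 r M T :=
    ((hT.relabel (i := 0) (j := 2) (by simp) (by simp)).relabel (i := 1) (j := 3) (by simp)
      (by simp)).congr (fun x hx y hy => by simp [r, hTS x hx, hTS y hy]) (fun x hx => by
        have := hL x
        simp only [M, hTS x hx, if_false]
        split_ifs <;> omega)
  have hU : Builds 4 r M (S ∪ T) := hMS.union hMT hST fun x hx y hy => by
    simp [r, hx, hTS y hy]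
  refine ((((((hU.join (i := 0) (j := 2) (by simp) (by simp) (by simp) (J 0 0)).join
    (i := 0) (j := 3) (by simp) (by simp) (by simp) (J 0 1)).join
    (i := 1) (j := 2) (by simp) (by simp) (by simp) (J 1 0)).join
    (i := 1) (j := 3) (by simp) (by simp) (by simp) (J 1 1)).relabel
    (i := 2) (j := 0) (by simp) (by simp)).relabel
    (i := 3) (j := 1) (by simp) (by simp)).congr (fun x hx y hy => ?_) (fun x hx => ?_)
  · have hxL : L x = 0 ∨ L x = 1 := by have := hL x; omega
    have hyL : L y = 0 ∨ L y = 1 := by have := hL y; omega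
    rcases hx with hx | hx <;> rcases hy with hy | hy
    · rcases hxL with h | h <;> rcases hyL with h' | h' <;> simp [r, M, hx, hy, h, h']
    · rw [hJ x hx y hy]
      rcases hxL with h | h <;> rcases hyL with h' | h' <;> simp [r, M, hx, hTS y hy, h, h']
    · rw [G.adj_comm, hJ y hy x hx]
      rcases hxL with h | h <;> rcases hyL with h' | h' <;> simp [r, M, hy, hTS x hx, h, h']
    · rcases hxL with h | h <;> rcases hyL with h' | h' <;>
        simp [r, M, hTS x hx, hTS y hy, h, h']
  · have hxL : L x = 0 ∨ L x = 1 := by have := hL x; omega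
    rcases hxL with h | h <;> by_cases hx' : x ∈ S <;> simp [M, h, hx']

theorem iUnion {G : SimpleGraph V} (hL : ∀ x, L x < 2) (J : ℕ → ℕ → Prop)
    {ι : Type*} [Finite ι] [Nonempty ι] {T : ι → Set V} (hT : ∀ i, Builds 4 G.Adj L (T i))
    (hd : ∀ i j, i ≠ j → Disjoint (T i) (T j))
    (hJ : ∀ i j, i ≠ j → ∀ x ∈ T i, ∀ y ∈ T j, G.Adj x y ↔ J (L x) (L y)) :
    Builds 4 G.Adj L (⋃ i, T i) := by
  classical
  have := Fintype.ofFinite ι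
  have key : ∀ s : Finset ι, s.Nonempty → Builds 4 G.Adj L (⋃ i ∈ s, T i) := by
    intro s hs
    induction hs using Finset.Nonempty.cons_induction with
    | singleton i => simpa using hT i
    | cons i s hi _ ih =>
      have hne : ∀ j ∈ s, i ≠ j := fun j hj h => hi (h ▸ hj)
      rw [Finset.cons_eq_insert, Finset.set_biUnion_insert]
      refine (hT i).combine hL J ih ?_ ?_
      · simp only [disjoint_iUnion_right]
        exact fun j hj => hd i j (hne j hj)
      · intro x hx y hy
        simp only [mem_iUnion] at hy
        obtain ⟨j, hj, hy⟩ := hy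
        exact hJ i j (hne j hj) x hx y hy
  simpa using key Finset.univ Finset.univ_nonempty

theorem splitCliqueWidth_le {G : SimpleGraph V} {A B : Set V} (h : Builds k G.Adj L univ)
    (hA : ∀ x ∈ A, L x = 0) (hB : ∀ x ∈ B, L x = 1) : splitCliqueWidth G A B ≤ k := by
  obtain ⟨e, he, f, hf, hS, hadj, hlab⟩ := h
  refine Nat.sInf_le ⟨e, he, Equiv.ofBijective f ⟨hf, range_eq_univ.1 hS⟩, hadj, fun u => ?_⟩
  rw [hlab]
  exact ⟨hA _, hB _⟩

end Builds

section S3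

variable {p q1 q2 : ℕ}

/-- A star center as a vertex of `S₃`. -/
def s3Center (c : Σ i, Fin (![q1, q2] i)) : Option (S2Verts 2 ![p, p + 1] ![q1, q2]) :=
  some (.inl c)

/-- A star leaf as a vertex of `S₃`. -/
def s3Leaf (e : Σ i, Fin (![q1, q2] i) × Fin (![p, p + 1] i)) :
    Option (S2Verts 2 ![p, p + 1] ![q1, q2]) :=
  some (.inr e)

@[simp] theorem s3Center_inj {c c'} :
    s3Center (p := p) (q1 := q1) (q2 := q2) c = s3Center c' ↔ c = c' :=
  (Option.some_injective _).eq_iff.trans Sum.inl_injective.eq_iff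

@[simp] theorem s3Leaf_inj {e e'} :
    s3Leaf (p := p) (q1 := q1) (q2 := q2) e = s3Leaf e' ↔ e = e' :=
  (Option.some_injective _).eq_iff.trans Sum.inr_injective.eq_iff

@[simp] theorem s3Center_ne_leaf (c e) :
    s3Center (p := p) (q1 := q1) (q2 := q2) c ≠ s3Leaf e := fun h =>
  Sum.inl_ne_inr (Option.some_injective _ h)

@[simp] theorem s3Leaf_ne_center (c e) :
    s3Leaf (p := p) (q1 := q1) (q2 := q2) e ≠ s3Center c := (s3Center_ne_leaf c e).symm

@[simp] theorem s3Center_ne_none (c) : s3Center (p := p) (q1 := q1) (q2 := q2) c ≠ none :=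
  Option.some_ne_none _

@[simp] theorem s3Leaf_ne_none (e) : s3Leaf (p := p) (q1 := q1) (q2 := q2) e ≠ none :=
  Option.some_ne_none _

@[simp] theorem none_ne_s3Center (c) : none ≠ s3Center (p := p) (q1 := q1) (q2 := q2) c :=
  (s3Center_ne_none c).symm

@[simp] theorem none_ne_s3Leaf (e) : none ≠ s3Leaf (p := p) (q1 := q1) (q2 := q2) e :=
  (s3Leaf_ne_none e).symm

/-- The label `a` on star centers and `b` on all other vertices of `S₃`. -/
def s3Label (p q1 q2 a b : ℕ) : Option (S2Verts 2 ![p, p + 1] ![q1, q2]) → ℕ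
  | some (.inl _) => a
  | some (.inr _) => b
  | none => b

/-- The star with center `⟨i, j⟩`. -/
def s3Star (i : Fin 2) (j : Fin (![q1, q2] i)) :
    Set (Option (S2Verts 2 ![p, p + 1] ![q1, q2])) :=
  (⋃ x, {s3Leaf ⟨i, j, x⟩}) ∪ {s3Center ⟨i, j⟩}

theorem mem_s3Star {i : Fin 2} {j : Fin (![q1, q2] i)}
    {x : Option (S2Verts 2 ![p, p + 1] ![q1, q2])} :
    x ∈ s3Star i j ↔ x = s3Center ⟨i, j⟩ ∨ ∃ y, x = s3Leaf ⟨i, j, y⟩ := by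
  simp [s3Star, eq_comm]

@[simp] theorem s3Label_center (a b : ℕ) (c) : s3Label p q1 q2 a b (s3Center c) = a := rfl

@[simp] theorem s3Label_leaf (a b : ℕ) (e) : s3Label p q1 q2 a b (s3Leaf e) = b := rfl

@[simp] theorem s3Label_none (a b : ℕ) : s3Label p q1 q2 a b none = b := rfl

theorem S2_adj_center_leaf (c e) :
    (S2 2 ![p, p + 1] ![q1, q2]).Adj (.inl c) (.inr e) ↔ leafCenter e = c :=
  ⟨fun h => h.2.elim id False.elim, fun h => ⟨Sum.inl_ne_inr, .inl h⟩⟩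

theorem S3_adj_center_leaf (c e) :
    (S3 p q1 q2).Adj (s3Center c) (s3Leaf e) ↔ leafCenter e = c :=
  ⟨fun h => h.2.elim (S2_adj_center_leaf c e).1 fun h => (S2_adj_center_leaf c e).1 h.symm,
    fun h => ⟨s3Center_ne_leaf c e, .inl ((S2_adj_center_leaf c e).2 h)⟩⟩

theorem S3_adj_center_none (c) : (S3 p q1 q2).Adj (s3Center c) none ↔ c.1 = 0 :=
  ⟨fun h => h.2.elim False.elim id, fun h => ⟨s3Center_ne_none c, .inr h⟩⟩

/-- A graph on the vertices of `S₃` in which the centers, and likewise the remaining vertices, are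
pairwise adjacent or pairwise nonadjacent, while the adjacency between the two classes is
complemented, can be built with four labels. -/
theorem builds_of_S3 (hp : 1 ≤ p) (hq1 : 1 ≤ q1) (hq2 : 1 ≤ q2) {a b : ℕ} (ha : a < 2)
    (hb : b < 2) (hab : a ≠ b) (PA PB : Prop)
    {G : SimpleGraph (Option (S2Verts 2 ![p, p + 1] ![q1, q2]))}
    (hAA : ∀ x ∈ S3A p q1 q2, ∀ y ∈ S3A p q1 q2, x ≠ y → (G.Adj x y ↔ PA))
    (hBB : ∀ x ∈ S3B p q1 q2, ∀ y ∈ S3B p q1 q2, x ≠ y → (G.Adj x y ↔ PB))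
    (hAB : ∀ x ∈ S3A p q1 q2, ∀ y ∈ S3B p q1 q2, G.Adj x y ↔ ¬ (S3 p q1 q2).Adj x y) :
    Builds 4 G.Adj (s3Label p q1 q2 a b) univ := by
  have hL : ∀ x, s3Label p q1 q2 a b x < 2 := by
    rintro (_ | _ | _) <;> assumption
  have hsing : ∀ x, Builds 4 G.Adj (s3Label p q1 q2 a b) {x} := fun x =>
    .singleton x ((hL x).trans (by simp)) (G.irrefl)
  have hcc : ∀ c c', c ≠ c' → (G.Adj (s3Center c) (s3Center c') ↔ PA) := fun c c' h =>
    hAA _ ⟨c, rfl⟩ _ ⟨c', rfl⟩ (s3Center_inj.not.2 h)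
  have hll : ∀ e e', e ≠ e' → (G.Adj (s3Leaf e) (s3Leaf e') ↔ PB) := fun e e' h =>
    hBB _ (.inr ⟨e, rfl⟩) _ (.inr ⟨e', rfl⟩) (s3Leaf_inj.not.2 h)
  have hlv : ∀ e, G.Adj (s3Leaf e) none ↔ PB := fun e =>
    hBB _ (.inr ⟨e, rfl⟩) _ (.inl rfl) (s3Leaf_ne_none e)
  have hcl : ∀ c e, G.Adj (s3Center c) (s3Leaf e) ↔ leafCenter e ≠ c := fun c e =>
    (hAB _ ⟨c, rfl⟩ _ (.inr ⟨e, rfl⟩)).trans (S3_adj_center_leaf c e).not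
  have hcv : ∀ c, G.Adj (s3Center c) none ↔ c.1 ≠ 0 := fun c =>
    (hAB _ ⟨c, rfl⟩ _ (.inl rfl)).trans (S3_adj_center_none c).not
  let J : ℕ → ℕ → Prop := fun m n => m ≠ n ∨ m = a ∧ PA ∨ m = b ∧ PB
  have hstars : ∀ i j i' j', (⟨i, j⟩ : Σ i, Fin (![q1, q2] i)) ≠ ⟨i', j'⟩ →
      ∀ x ∈ s3Star i j, ∀ y ∈ s3Star i' j',
        x ≠ y ∧ (G.Adj x y ↔ J (s3Label p q1 q2 a b x) (s3Label p q1 q2 a b y)) := by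
    intro i j i' j' hne x hx y hy
    have hl : ∀ z z', (⟨i, j, z⟩ : Σ i, Fin (![q1, q2] i) × Fin (![p, p + 1] i)) ≠
        ⟨i', j', z'⟩ := fun z z' h => hne (congrArg leafCenter h)
    rcases mem_s3Star.1 hx with rfl | ⟨z, rfl⟩ <;> rcases mem_s3Star.1 hy with rfl | ⟨z', rfl⟩
    · exact ⟨by simpa using hne, by simp [hcc _ _ hne, J, hab]⟩
    · exact ⟨by simp, by simp [hcl, J, hab, leafCenter, hne.symm]⟩
    · exact ⟨by simp, by simp [G.adj_comm, hcl, J, hab.symm, leafCenter, hne]⟩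
    · exact ⟨by simpa using hl z z', by simp [hll _ _ (hl z z'), J, hab.symm]⟩
  have hstar : ∀ i j, Builds 4 G.Adj (s3Label p q1 q2 a b) (s3Star i j) := by
    intro i j
    have : Nonempty (Fin (![p, p + 1] i)) := ⟨⟨0, by fin_cases i <;> simp; omega⟩⟩
    refine Builds.combine hL (fun _ _ => False)
      (.iUnion hL (fun _ _ => PB) (fun x => hsing _) ?_ ?_) (hsing _) ?_ ?_
    · intro x y h
      simpa using h
    · intro x y h
      simp only [mem_singleton_iff, forall_eq]
      exact hll _ _ (by simpa using h)
    · simp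
    · simp [G.adj_comm, hcl, leafCenter]
  have hblock : ∀ i, Builds 4 G.Adj (s3Label p q1 q2 a b) (⋃ j, s3Star i j) := by
    intro i
    have : Nonempty (Fin (![q1, q2] i)) := ⟨⟨0, by fin_cases i <;> simp <;> omega⟩⟩
    refine .iUnion hL J (hstar i) (fun j j' h => ?_) (fun j j' h x hx y hy => ?_)
    · exact disjoint_left.2 fun x hx hx' => (hstars i j i j' (by simpa using h) x hx x hx').1 rfl
    · exact (hstars i j i j' (by simpa using h) x hx y hy).2
  have hnone : Builds 4 G.Adj (s3Label p q1 q2 a b) ((⋃ j, s3Star 0 j) ∪ {none}) := by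
    refine (hblock 0).combine hL (fun m _ => m = b ∧ PB) (hsing _) ?_ ?_
    · refine disjoint_singleton_right.2 fun h => ?_
      obtain ⟨j, h⟩ := mem_iUnion.1 h
      simp [mem_s3Star] at h
    · rintro x hx _ rfl
      obtain ⟨j, hx⟩ := mem_iUnion.1 hx
      rcases mem_s3Star.1 hx with rfl | ⟨z, rfl⟩
      · simp [hcv, hab]
      · simp [hlv]
  have hall := hnone.combine hL J (hblock 1) ?_ ?_
  · convert hall
    refine (eq_univ_of_forall ?_).symm
    rintro (_ | ⟨i, j⟩ | ⟨i, j, z⟩)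
    · simp
    · fin_cases i
      · exact .inl (.inl (mem_iUnion.2 ⟨j, mem_s3Star.2 (.inl rfl)⟩))
      · exact .inr (mem_iUnion.2 ⟨j, mem_s3Star.2 (.inl rfl)⟩)
    · fin_cases i
      · exact .inl (.inl (mem_iUnion.2 ⟨j, mem_s3Star.2 (.inr ⟨z, rfl⟩)⟩))
      · exact .inr (mem_iUnion.2 ⟨j, mem_s3Star.2 (.inr ⟨z, rfl⟩)⟩)
  · refine disjoint_left.2 fun x hx hx' => ?_
    obtain ⟨j', hx'⟩ := mem_iUnion.1 hx'
    rcases hx with hx | rfl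
    · obtain ⟨j, hx⟩ := mem_iUnion.1 hx
      exact (hstars 0 j 1 j' (fun h => by simpa using congrArg Sigma.fst h) x hx x hx').1 rfl
    · simp [mem_s3Star] at hx'
  · intro x hx y hy
    obtain ⟨j', hy⟩ := mem_iUnion.1 hy
    rcases hx with hx | rfl
    · obtain ⟨j, hx⟩ := mem_iUnion.1 hx
      exact (hstars 0 j 1 j' (fun h => by simpa using congrArg Sigma.fst h) x hx y hy).2
    · rw [G.adj_comm]
      rcases mem_s3Star.1 hy with rfl | ⟨z, rfl⟩
      · simp [hcv, J, hab.symm]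
      · simp [hlv, J, hab.symm]

theorem S3_isSplitted : IsSplitted (S3 p q1 q2) (S3A p q1 q2) (S3B p q1 q2) := by
  refine ⟨eq_univ_of_forall ?_, disjoint_left.2 ?_, ?_, ?_⟩
  · rintro (_ | c | e)
    · exact .inr (.inl rfl)
    · exact .inl ⟨c, rfl⟩
    · exact .inr (.inr ⟨e, rfl⟩)
  · rintro _ ⟨c, rfl⟩ (h | ⟨e, h⟩)
    · exact s3Center_ne_none c h
    · exact s3Center_ne_leaf c e h
  · rintro _ ⟨c, rfl⟩ _ ⟨c', rfl⟩ h
    exact ⟨h, .inl ⟨fun h' => h (congrArg some h'), .inl trivial⟩⟩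
  · rintro _ (rfl | ⟨e, rfl⟩) _ (rfl | ⟨e', rfl⟩) h
    · exact h.1 rfl
    · exact h.2.elim id id
    · exact h.2.elim id id
    · exact h.2.elim (fun h => h.2.elim id id) (fun h => h.2.elim id id)

end S3

theorem stmt18 (p q1 q2 : ℕ) (hp : 1 ≤ p) (hq1 : 2 ≤ q1) (hq2 : 1 ≤ q2) :
    splitCliqueWidth (S3 p q1 q2)ᶜ (S3B p q1 q2) (S3A p q1 q2) ≤ 4 ∧
    splitCliqueWidth (splitInverse (S3 p q1 q2) (S3A p q1 q2) (S3B p q1 q2))ᶜ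
      (S3A p q1 q2) (S3B p q1 q2) ≤ 4 := by
  obtain ⟨-, hd, hclique, hind⟩ := S3_isSplitted (p := p) (q1 := q1) (q2 := q2)
  have hA : ∀ a b, ∀ x ∈ S3A p q1 q2, s3Label p q1 q2 a b x = a := by
    rintro a b _ ⟨c, rfl⟩
    rfl
  have hB : ∀ a b, ∀ x ∈ S3B p q1 q2, s3Label p q1 q2 a b x = b := by
    rintro a b _ (rfl | ⟨e, rfl⟩) <;> rfl
  have hAB : ∀ x ∈ S3A p q1 q2, x ∉ S3B p q1 q2 := fun _ hx => disjoint_left.1 hd hx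
  have hBA : ∀ x ∈ S3B p q1 q2, x ∉ S3A p q1 q2 := fun _ hx => disjoint_right.1 hd hx
  constructor
  · refine (builds_of_S3 hp (by omega) hq2 (a := 1) (b := 0) (by simp) (by simp) (by simp)
      False True ?_ ?_ ?_).splitCliqueWidth_le (hB _ _) (hA _ _)
    · intro x hx y hy h
      simp [hclique x hx y hy h]
    · intro x hx y hy h
      simp [hind x hx y hy, h]
    · intro x hx y hy
      simp [hd.ne_of_mem hx hy]
  · refine (builds_of_S3 hp (by omega) hq2 (a := 0) (b := 1) (by simp) (by simp) (by simp)
      True False ?_ ?_ ?_).splitCliqueWidth_le (hA _ _) (hB _ _)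
    · intro x hx y hy h
      simp [splitInverse, hx, hy, hAB x hx, h]
    · intro x hx y hy h
      simp [splitInverse, hx, hy, h]
    · intro x hx y hy
      simp [splitInverse, hx, hAB x hx, hBA y hy, hd.ne_of_mem hx hy,
        (S3 p q1 q2).adj_comm y x]

end CWPaper
end

section
/- For all parameters p ≥ 1 and q ≥ 1: the split clique-width of S_4(p, q) is at most 4, the split clique-width of its inverse is at most 4, the split clique-width of its complement is at most 5, and the split clique-width of its inverse-complement is at most 5. -/
namespace CWPaper

/-! ## Building graphs one vertex set at a time -/

/-- Some `k`-expression constructs the graph induced by `R` on `S`, with final labels `L`. The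
empty vertex set is allowed, although no expression constructs it. -/
def Buildable {V : Type*} (k : ℕ) (S : Set V) (R : V → V → Prop) (L : V → ℕ) : Prop :=
  S = ∅ ∨ ∃ e : Expr, e.Valid k ∧ ∃ f : e.Verts ≃ S,
    (∀ u v, R (f u) (f v) ↔ e.adj u v) ∧ ∀ u, e.label u = L (f u)

/-- The pair of labels `{i, j}` is one of the pairs listed in `J`. -/
def JoinRel (J : List (ℕ × ℕ)) (i j : ℕ) : Prop := (i, j) ∈ J ∨ (j, i) ∈ J

/-- The effect on a label of performing the relabelings in the list one after the other. -/
def relabelBy : List (ℕ × ℕ) → ℕ → ℕ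
  | [], n => n
  | p :: l, n => relabelBy l (if n = p.1 then p.2 else n)

namespace Buildable

variable {V : Type*} {k : ℕ} {S T : Set V} {R R' : V → V → Prop} {L L' : V → ℕ}

theorem congr (h : Buildable k S R L) (hR : ∀ x ∈ S, ∀ y ∈ S, (R x y ↔ R' x y))
    (hL : ∀ x ∈ S, L x = L' x) : Buildable k S R' L' := by
  rcases h with h | ⟨e, he, f, h1, h2⟩
  · exact Or.inl h
  · refine Or.inr ⟨e, he, f, fun u v => ?_, fun u => ?_⟩
    · rw [← h1, hR _ (f u).2 _ (f v).2]
    · rw [h2, hL _ (f u).2]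

theorem singleton (a : V) (hR : ¬ R a a) (hL : L a < k) : Buildable k {a} R L := by
  refine Or.inr ⟨.vert (L a), hL, (Equiv.ofUnique Unit ({a} : Set V) : _), fun u v => ?_,
    fun u => ?_⟩
  · have h (x : ({a} : Set V)) : (x : V) = a := x.2
    simp [h, hR, Expr.adj]
  · have h (x : ({a} : Set V)) : (x : V) = a := x.2
    simp [h, Expr.label]

theorem join {i j : ℕ} (h : Buildable k S R L) (hi : i < k) (hj : j < k) (hij : i ≠ j) :
    Buildable k S
      (fun x y => R x y ∨ (L x = i ∧ L y = j) ∨ (L x = j ∧ L y = i)) L := by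
  rcases h with h | ⟨e, he, f, h1, h2⟩
  · exact Or.inl h
  · refine Or.inr ⟨.join i j e, ⟨hi, hj, hij, he⟩, f, fun u v => ?_, h2⟩
    change R (f u) (f v) ∨ (L (f u) = i ∧ L (f v) = j) ∨ (L (f u) = j ∧ L (f v) = i) ↔
      e.adj u v ∨ (e.label u = i ∧ e.label v = j) ∨ (e.label u = j ∧ e.label v = i)
    rw [← h1 u v, h2 u, h2 v]

theorem joins {J : List (ℕ × ℕ)} (h : Buildable k S R L)
    (hJ : ∀ p ∈ J, p.1 < k ∧ p.2 < k ∧ p.1 ≠ p.2) :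
    Buildable k S (fun x y => R x y ∨ JoinRel J (L x) (L y)) L := by
  induction J with
  | nil => exact h.congr (by simp [JoinRel]) (by simp)
  | cons p J ih =>
    obtain ⟨h1, h2, h3⟩ := hJ p (by simp)
    refine ((ih fun q hq => hJ q (by simp [hq])).join h1 h2 h3).congr ?_ (by simp)
    intro x _ y _
    simp only [JoinRel, List.mem_cons, Prod.ext_iff]
    tauto

theorem relabel {l : List (ℕ × ℕ)} (h : Buildable k S R L)
    (hl : ∀ p ∈ l, p.1 < k ∧ p.2 < k) :
    Buildable k S R (fun x => relabelBy l (L x)) := by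
  induction l generalizing L with
  | nil => exact h
  | cons p l ih =>
    obtain ⟨h1, h2⟩ := hl p (by simp)
    refine ih (L := fun x => if L x = p.1 then p.2 else L x) ?_ fun q hq => hl q (by simp [hq])
    rcases h with h | ⟨e, he, f, h3, h4⟩
    · exact Or.inl h
    · exact Or.inr ⟨.relabel p.1 p.2 e, ⟨h1, h2, he⟩, f, h3, fun u =>
        congrArg (fun n => if n = p.1 then p.2 else n) (h4 u)⟩

open Classical in
theorem disjointUnion (hS : Buildable k S R L) (hT : Buildable k T R L') (hd : Disjoint S T) :
    Buildable k (S ∪ T) (fun x y => R x y ∧ (x ∈ S ↔ y ∈ S))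
      (fun x => if x ∈ S then L x else L' x) := by
  have hd' : ∀ x ∈ T, x ∉ S := fun x hx hx' => Set.disjoint_left.1 hd hx' hx
  rcases hS with rfl | ⟨e, he, f, h1, h2⟩
  · rw [Set.empty_union]
    exact hT.congr (by simp) (by simp)
  rcases hT with rfl | ⟨e', he', f', h1', h2'⟩
  · rw [Set.union_empty]
    refine congr (Or.inr ⟨e, he, f, h1, h2⟩) ?_ ?_
    · intro x hx y hy
      simp [hx, hy]
    · intro x hx
      simp [hx]
  refine Or.inr ⟨.union e e', ⟨he, he'⟩,
    ((Equiv.sumCongr f f').trans (Equiv.Set.union hd).symm : _), ?_, ?_⟩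
  · rintro (u | u) (v | v)
    · change R (f u) (f v) ∧ ((f u : V) ∈ S ↔ (f v : V) ∈ S) ↔ e.adj u v
      simp [h1]
    · change R (f u) (f' v) ∧ ((f u : V) ∈ S ↔ (f' v : V) ∈ S) ↔ False
      simp [hd' _ (f' v).2]
    · change R (f' u) (f v) ∧ ((f' u : V) ∈ S ↔ (f v : V) ∈ S) ↔ False
      simp [hd' _ (f' u).2]
    · change R (f' u) (f' v) ∧ ((f' u : V) ∈ S ↔ (f' v : V) ∈ S) ↔ e'.adj u v
      simp [h1', hd' _ (f' u).2, hd' _ (f' v).2]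
  · rintro (u | u)
    · change e.label u = if (f u : V) ∈ S then L (f u) else L' (f u)
      simp [h2]
    · change e'.label u = if (f' u : V) ∈ S then L (f' u) else L' (f' u)
      simp [h2', hd' _ (f' u).2]

/-- Take a disjoint union, perform the joins in `J` and then the relabelings in `l`. -/
theorem union {M : V → ℕ} (J l : List (ℕ × ℕ)) (hS : Buildable k S R L)
    (hT : Buildable k T R L') (hd : Disjoint S T) (hsymm : ∀ x y, R x y → R y x)
    (hJ : ∀ p ∈ J, p.1 < k ∧ p.2 < k ∧ p.1 ≠ p.2) (hl : ∀ p ∈ l, p.1 < k ∧ p.2 < k)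
    (hST : ∀ x ∈ S, ∀ y ∈ T, (R x y ↔ JoinRel J (L x) (L' y)))
    (hSS : ∀ x ∈ S, ∀ y ∈ S, JoinRel J (L x) (L y) → R x y)
    (hTT : ∀ x ∈ T, ∀ y ∈ T, JoinRel J (L' x) (L' y) → R x y)
    (hMS : ∀ x ∈ S, relabelBy l (L x) = M x) (hMT : ∀ x ∈ T, relabelBy l (L' x) = M x) :
    Buildable k (S ∪ T) R M := by
  classical
  have hd' : ∀ x ∈ T, x ∉ S := fun x hx hx' => Set.disjoint_left.1 hd hx' hx
  have hcomm (i j) : JoinRel J i j ↔ JoinRel J j i := Or.comm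
  refine (((disjointUnion hS hT hd).joins hJ).relabel hl).congr ?_ ?_
  · rintro x (hx | hx) y (hy | hy)
    · have := hSS x hx y hy
      simp only [hx, hy, if_true]
      tauto
    · have := hST x hx y hy
      simp only [hx, hd' y hy, if_true, if_false]
      tauto
    · have := hST y hy x hx
      have := hcomm (L y) (L' x)
      have := hsymm x y
      have := hsymm y x
      simp only [hy, hd' x hx, if_true, if_false]
      tauto
    · have := hTT x hx y hy
      simp only [hd' x hx, hd' y hy, if_false]
      tauto
  · rintro x (hx | hx)
    · simp only [hx, if_true, hMS x hx]
    · simp only [hd' x hx, if_false, hMT x hx]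

end Buildable

theorem splitCliqueWidth_le_of_buildable {V : Type*} [Nonempty V] {k : ℕ} {G : SimpleGraph V}
    {A B : Set V} {L : V → ℕ} (h : Buildable k Set.univ G.Adj L)
    (hA : ∀ x ∈ A, L x = 0) (hB : ∀ x ∈ B, L x = 1) : splitCliqueWidth G A B ≤ k := by
  rcases h with h | ⟨e, he, f, h1, h2⟩
  · exact absurd h Set.univ_nonempty.ne_empty
  · exact Nat.sInf_le ⟨e, he, f.trans (Equiv.Set.univ V), h1, fun u =>
      ⟨fun hu => (h2 u).trans (hA _ hu), fun hu => (h2 u).trans (hB _ hu)⟩⟩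

/-! ## Stars with two extra vertices -/

section ExtendedStars

variable {K E : Type*}

/-- The common shape of the four graphs obtained from `S₄`. The vertices are the clique vertex
`none`, the independent vertex `some none`, the centers in `K`, and the leaves in `E`, where `π`
gives the center of each leaf and `K₀` is the set of neighbors of `some none`. The centers form a
clique if `a` holds and the leaves do otherwise; the edges between the two sides are complemented
if `c` holds. -/
def ExtAdj (π : E → K) (K₀ : Set K) (a c : Bool) :
    Option (Option (K ⊕ E)) → Option (Option (K ⊕ E)) → Prop
  | none, none => False
  | none, some none => c = true
  | none, some (some (.inl _)) => a = true
  | none, some (some (.inr _)) => c = false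
  | some none, none => c = true
  | some none, some none => False
  | some none, some (some (.inl x)) => (x ∈ K₀ ↔ c = false)
  | some none, some (some (.inr _)) => a = false
  | some (some (.inl _)), none => a = true
  | some (some (.inl x)), some none => (x ∈ K₀ ↔ c = false)
  | some (some (.inl x)), some (some (.inl y)) => a = true ∧ x ≠ y
  | some (some (.inl x)), some (some (.inr e)) => (π e = x ↔ c = false)
  | some (some (.inr _)), none => c = false
  | some (some (.inr _)), some none => a = false
  | some (some (.inr e)), some (some (.inl x)) => (π e = x ↔ c = false)
  | some (some (.inr d)), some (some (.inr e)) => a = false ∧ d ≠ e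

/-- The labeling with labels `u`, `v`, `x`, `y` on `none`, `some none`, the centers and the
leaves. -/
def extLabel (u v x y : ℕ) : Option (Option (K ⊕ E)) → ℕ
  | none => u
  | some none => v
  | some (some (.inl _)) => x
  | some (some (.inr _)) => y

/-- The centers in `C` together with their leaves. -/
def starVerts (π : E → K) (C : Set K) : Set (Option (Option (K ⊕ E))) :=
  {z | ∃ w, z = some (some w) ∧ Sum.elim id π w ∈ C}

variable {π : E → K} {K₀ : Set K} {a c : Bool}

theorem ExtAdj.symm {x y : Option (Option (K ⊕ E))} (h : ExtAdj π K₀ a c x y) :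
    ExtAdj π K₀ a c y x := by
  rcases x with _ | _ | x | x <;> rcases y with _ | _ | y | y <;>
    simp_all [ExtAdj, eq_comm]

/-- The number of labels used. -/
def extWidth : Bool → ℕ
  | false => 4
  | true => 5

/-- The final label of the centers. -/
def centerLabel : Bool → ℕ
  | true => 0
  | false => 1

/-- The final label of the leaves. -/
def leafLabel : Bool → ℕ
  | true => 1
  | false => 0

/-- The label of the center of a star that has just been built. -/
def newCenterLabel : Bool → Bool → ℕ
  | false, false => 1
  | _, _ => 2

/-- The label of the leaves of a star that has just been built. -/
def newLeafLabel : Bool → Bool → ℕ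
  | true, false => 1
  | false, false => 2
  | _, true => 3

/-- The label of the vertex `some none` while stars are being inserted. -/
def extraLabel : Bool → ℕ
  | false => 3
  | true => 4

/-- The joins performed when inserting one more star. -/
def starJoins : Bool → Bool → List (ℕ × ℕ)
  | true, false => [(0, 2)]
  | false, false => [(0, 2), (3, 2)]
  | true, true => [(0, 2), (0, 3), (1, 2), (4, 2)]
  | false, true => [(0, 3), (4, 3), (1, 3), (0, 2), (4, 2)]

/-- The relabelings performed after inserting one more star. -/
def starRelabels (a c : Bool) : List (ℕ × ℕ) :=
  [(newCenterLabel a c, centerLabel a), (newLeafLabel a c, leafLabel a)]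

theorem buildable_leaves (s : Finset E) :
    Buildable (extWidth c) ((fun e => some (some (.inr e))) '' (s : Set E)) (ExtAdj π K₀ a c)
      (extLabel 0 0 0 (newLeafLabel a c)) := by
  classical
  induction s using Finset.induction_on with
  | empty => exact Or.inl (by simp)
  | insert e s he ih =>
    have h1 : Buildable (extWidth c) {some (some (.inr e))} (ExtAdj π K₀ a c)
        (extLabel 0 0 0 (if a then newLeafLabel a c else extraLabel c)) :=
      .singleton _ (by simp [ExtAdj])
        (by cases a <;> cases c <;>
          simp [extLabel, newLeafLabel, extraLabel, extWidth])
    rw [Finset.coe_insert, Set.image_insert_eq, Set.insert_eq, Set.union_comm]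
    refine ih.union (if a then [] else [(newLeafLabel a c, extraLabel c)])
      (if a then [] else [(extraLabel c, newLeafLabel a c)]) h1 ?_ (fun _ _ => ExtAdj.symm)
      ?_ ?_ ?_ ?_ ?_ ?_ ?_
    · simpa using he
    · cases a <;> cases c <;> decide
    · cases a <;> cases c <;> decide
    · rintro _ ⟨d, hd, rfl⟩ _ rfl
      have : d ≠ e := fun h => he (h ▸ hd)
      cases a <;> cases c <;> simp [ExtAdj, extLabel, JoinRel, newLeafLabel, extraLabel, this]
    · rintro _ ⟨d, hd, rfl⟩ _ ⟨d', hd', rfl⟩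
      cases a <;> cases c <;> simp [extLabel, JoinRel, newLeafLabel, extraLabel]
    · rintro _ rfl _ rfl
      cases a <;> cases c <;> simp [extLabel, JoinRel, newLeafLabel, extraLabel]
    · rintro _ ⟨d, hd, rfl⟩
      cases a <;> cases c <;> simp [extLabel, relabelBy, newLeafLabel, extraLabel]
    · rintro _ rfl
      cases a <;> cases c <;> simp [extLabel, relabelBy, newLeafLabel, extraLabel]

theorem buildable_star [Finite E] (x : K) :
    Buildable (extWidth c) (starVerts π {x}) (ExtAdj π K₀ a c)
      (extLabel 0 0 (newCenterLabel a c) (newLeafLabel a c)) := by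
  classical
  have := Fintype.ofFinite E
  have h1 : Buildable (extWidth c) {some (some (.inl x))} (ExtAdj π K₀ a c)
      (extLabel 0 0 (newCenterLabel a c) 0) :=
    .singleton _ (by simp [ExtAdj])
      (by cases a <;> cases c <;> simp [extLabel, newCenterLabel, extWidth])
  have h2 : starVerts π {x} =
      (fun e => some (some (.inr e))) ''
        ((Finset.univ.filter fun e => π e = x : Finset E) : Set E) ∪ {some (some (.inl x))} := by
    ext (_ | _ | y | y) <;> simp [starVerts]
  rw [h2]
  refine (buildable_leaves _).union (if c then [] else [(newLeafLabel a c, newCenterLabel a c)])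
    [] h1 ?_ (fun _ _ => ExtAdj.symm) ?_ ?_ ?_ ?_ ?_ ?_ ?_
  · simp
  · cases a <;> cases c <;> decide
  · simp
  · rintro _ ⟨d, hd, rfl⟩ _ rfl
    have : π d = x := by simpa using hd
    cases a <;> cases c <;>
      simp [ExtAdj, extLabel, JoinRel, newLeafLabel, newCenterLabel, this]
  · rintro _ ⟨d, hd, rfl⟩ _ ⟨d', hd', rfl⟩
    cases a <;> cases c <;> simp [extLabel, JoinRel, newLeafLabel, newCenterLabel]
  · rintro _ rfl _ rfl
    cases a <;> cases c <;> simp [extLabel, JoinRel, newLeafLabel, newCenterLabel]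
  · rintro _ ⟨d, hd, rfl⟩
    simp [extLabel, relabelBy]
  · rintro _ rfl
    simp [extLabel, relabelBy]

/-- The labeling used while stars are being inserted. -/
abbrev partialLabel (a c : Bool) : Option (Option (K ⊕ E)) → ℕ :=
  extLabel 0 (extraLabel c) (centerLabel a) (leafLabel a)

theorem Buildable.insert_star [Finite E] {S : Set (Option (Option (K ⊕ E)))} {x : K}
    (h : Buildable (extWidth c) S (ExtAdj π K₀ a c) (partialLabel a c))
    (hu : none ∉ S) (hv : some none ∈ S → x ∉ K₀) (hd : Disjoint S (starVerts π {x})) :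
    Buildable (extWidth c) (S ∪ starVerts π {x}) (ExtAdj π K₀ a c) (partialLabel a c) := by
  have hd' : ∀ w, some (some w) ∈ S → Sum.elim id π w ≠ x := fun w hw hx =>
    Set.disjoint_left.1 hd hw ⟨w, rfl, hx⟩
  refine h.union (starJoins a c) (starRelabels a c) (buildable_star x) hd
    (fun _ _ => ExtAdj.symm) ?_ ?_ ?_ ?_ ?_ ?_ ?_
  · cases a <;> cases c <;> decide
  · cases a <;> cases c <;> decide
  · rintro y hy _ ⟨z, rfl, rfl⟩
    rcases y with _ | _ | y | y
    · exact absurd hy hu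
    · have := hv hy
      rcases z with z | z <;> cases a <;> cases c <;>
        simp_all [ExtAdj, extLabel, JoinRel, newLeafLabel, newCenterLabel, starJoins, extraLabel]
    all_goals
      have := hd' _ hy
      have h3 : ∀ d e : E, π d ≠ π e → d ≠ e := fun d e hde h => hde (h ▸ rfl)
      rcases z with z | z <;> cases a <;> cases c <;>
        simp_all [ExtAdj, extLabel, JoinRel, newLeafLabel, newCenterLabel, starJoins,
          centerLabel, leafLabel, eq_comm]
  · rintro y - z -
    rcases y with _ | _ | y | y <;> rcases z with _ | _ | z | z <;> cases a <;> cases c <;>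
      simp [extLabel, JoinRel, starJoins, extraLabel, centerLabel, leafLabel]
  · rintro _ ⟨y, rfl, hy⟩ _ ⟨z, rfl, hz⟩
    rcases y with y | y <;> rcases z with z | z <;> cases a <;> cases c <;>
      simp [extLabel, JoinRel, starJoins, newCenterLabel, newLeafLabel]
  · rintro y hy
    rcases y with _ | _ | y | y
    · exact absurd hy hu
    all_goals
      cases a <;> cases c <;> simp [extLabel, relabelBy, starRelabels, newCenterLabel,
        newLeafLabel, centerLabel, leafLabel, extraLabel]
  · rintro _ ⟨y, rfl, hy⟩
    rcases y with y | y <;> cases a <;> cases c <;> simp [extLabel, relabelBy, starRelabels,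
      newCenterLabel, newLeafLabel, centerLabel, leafLabel]

theorem Buildable.insert_stars [Finite E] {S : Set (Option (Option (K ⊕ E)))}
    (h : Buildable (extWidth c) S (ExtAdj π K₀ a c) (partialLabel a c)) (C : Finset K)
    (hu : none ∉ S) (hv : some none ∈ S → ∀ x ∈ C, x ∉ K₀)
    (hd : Disjoint S (starVerts π C)) :
    Buildable (extWidth c) (S ∪ starVerts π C) (ExtAdj π K₀ a c) (partialLabel a c) := by
  classical
  induction C using Finset.induction_on with
  | empty =>
    have : starVerts π ((∅ : Finset K) : Set K) = ∅ := by
      simp [starVerts]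
    rwa [this, Set.union_empty]
  | insert x C hx ih =>
    have h1 : starVerts π ((insert x C : Finset K) : Set K) =
        starVerts π (C : Set K) ∪ starVerts π {x} := by
      ext (_ | _ | y | y) <;> simp [starVerts, or_comm]
    rw [h1, Set.disjoint_union_right] at hd
    rw [h1, ← Set.union_assoc]
    refine (ih (fun h y hy => hv h y (by simp [hy])) hd.1).insert_star ?_ ?_ ?_
    · simp [hu, starVerts]
    · intro h2
      exact hv (by simpa [starVerts] using h2) x (by simp)
    · rw [Set.disjoint_union_left]
      refine ⟨hd.2, Set.disjoint_left.2 ?_⟩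
      rintro _ ⟨y, rfl, hy⟩ ⟨z, hz, hz'⟩
      obtain rfl : y = z := by simpa using hz
      rw [Set.mem_singleton_iff] at hz'
      exact hx (hz' ▸ hy)

theorem buildable_extAdj [Finite K] [Finite E] :
    Buildable (extWidth c) Set.univ (ExtAdj π K₀ a c)
      (extLabel (centerLabel a) (leafLabel a) (centerLabel a) (leafLabel a)) := by
  classical
  have := Fintype.ofFinite K
  have h0 : Buildable (extWidth c) (∅ : Set (Option (Option (K ⊕ E)))) (ExtAdj π K₀ a c)
      (partialLabel a c) := Or.inl rfl
  have h1 := h0.insert_stars (Finset.univ.filter (· ∈ K₀)) (by simp) (by simp) (by simp)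
  have hv : Buildable (extWidth c) {some none} (ExtAdj π K₀ a c) (partialLabel a c) :=
    .singleton _ (by simp [ExtAdj]) (by cases c <;> simp [extLabel, extraLabel, extWidth])
  have h2 := h1.union (M := partialLabel a c)
    ((if c then [] else [(extraLabel c, centerLabel a)]) ++
    (if a then [] else [(extraLabel c, leafLabel a)])) [] hv
      (by simp [starVerts]) (fun _ _ => ExtAdj.symm)
      (by cases a <;> cases c <;> decide) (by simp)
      (by
        rintro y hy _ rfl
        rcases y with _ | _ | y | y <;> cases a <;> cases c <;>
          simp_all [starVerts, ExtAdj, extLabel, JoinRel, extraLabel, centerLabel, leafLabel])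
      (by
        rintro y hy z hz
        rcases y with _ | _ | y | y <;> rcases z with _ | _ | z | z <;> cases a <;> cases c <;>
          simp_all [starVerts, extLabel, JoinRel, extraLabel, centerLabel, leafLabel])
      (by
        rintro _ rfl _ rfl
        cases a <;> cases c <;> simp [extLabel, JoinRel, extraLabel, centerLabel, leafLabel])
      (by simp [relabelBy]) (by simp [relabelBy])
  have h3 := h2.insert_stars (Finset.univ.filter (· ∉ K₀)) (by simp [starVerts]) (by simp) (by
    refine Set.disjoint_left.2 ?_
    rintro (_ | _ | y | y) <;> simp [starVerts])
  have hu : Buildable (extWidth c) {none} (ExtAdj π K₀ a c)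
      (extLabel 2 0 0 0) :=
    .singleton _ (by simp [ExtAdj]) (by cases c <;> simp [extLabel, extWidth])
  have hS : ∅ ∪ starVerts π ((Finset.univ.filter (· ∈ K₀) : Finset K) : Set K) ∪ {some none} ∪
      starVerts π ((Finset.univ.filter (· ∉ K₀) : Finset K) : Set K) = {none}ᶜ := by
    ext (_ | _ | y | y) <;> simp [starVerts, em]
  rw [hS] at h3
  rw [← Set.compl_union_self {none}]
  refine h3.union ((if a then [(2, centerLabel a)] else []) ++
    (if c then [(2, extraLabel c)] else [(2, leafLabel a)]))
    [(2, centerLabel a), (extraLabel c, leafLabel a)] hu disjoint_compl_left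
    (fun _ _ => ExtAdj.symm) ?_ ?_ ?_ ?_ ?_ ?_ ?_
  · cases a <;> cases c <;> decide
  · cases a <;> cases c <;> decide
  · rintro y hy _ rfl
    rcases y with _ | _ | y | y <;> cases a <;> cases c <;>
      simp_all [ExtAdj, extLabel, JoinRel, extraLabel, centerLabel, leafLabel]
  · rintro y hy z hz
    rcases y with _ | _ | y | y <;> rcases z with _ | _ | z | z <;> cases a <;> cases c <;>
      simp_all [extLabel, JoinRel, extraLabel, centerLabel, leafLabel]
  · rintro _ rfl _ rfl
    cases a <;> cases c <;> simp [extLabel, JoinRel, extraLabel, centerLabel, leafLabel]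
  · rintro y hy
    rcases y with _ | _ | y | y <;> cases a <;> cases c <;>
      simp_all [extLabel, relabelBy, extraLabel, centerLabel, leafLabel]
  · rintro _ rfl
    cases a <;> cases c <;> simp [extLabel, relabelBy, extraLabel, centerLabel]

theorem ExtAdj.compl_iff {x y : Option (Option (K ⊕ E))} :
    x ≠ y ∧ ¬ ExtAdj π K₀ a c x y ↔ ExtAdj π K₀ (!a) (!c) x y := by
  rcases x with _ | _ | x | x <;> rcases y with _ | _ | y | y <;> cases a <;> cases c <;>
    simp [ExtAdj]

variable (π K₀)

/-- The graph `S₂`, for an arbitrary assignment `π` of leaves to centers. -/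
def starGraph : SimpleGraph (K ⊕ E) :=
  SimpleGraph.fromRel fun x y =>
    match x, y with
    | .inl _, .inl _ => True
    | .inl c, .inr e => π e = c
    | _, _ => False

/-- The graph `S₃`, for an arbitrary assignment `π` of leaves to centers and an arbitrary set `K₀`
of neighbors of the extra independent vertex. -/
def starGraphWithVertex : SimpleGraph (Option (K ⊕ E)) :=
  SimpleGraph.fromRel fun x y =>
    match x, y with
    | some a, some b => (starGraph π).Adj a b
    | none, some (.inl c) => c ∈ K₀
    | _, _ => False

/-- The graph `S₄`, for an arbitrary assignment `π` of leaves to centers and an arbitrary set `K₀`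
of neighbors of the extra independent vertex. -/
def extGraph : SimpleGraph (Option (Option (K ⊕ E))) :=
  SimpleGraph.fromRel fun x y =>
    match x, y with
    | some a, some b => (starGraphWithVertex π K₀).Adj a b
    | none, some (some _) => True
    | _, _ => False

theorem extGraph_adj (x y : Option (Option (K ⊕ E))) :
    (extGraph π K₀).Adj x y ↔ ExtAdj π K₀ true false x y := by
  rcases x with _ | _ | x | x <;> rcases y with _ | _ | y | y <;>
    simp [extGraph, starGraphWithVertex, starGraph, ExtAdj]
  grind

theorem splitInverse_extGraph_adj (x y : Option (Option (K ⊕ E))) :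
    (splitInverse (extGraph π K₀) {x | x = none ∨ ∃ c, x = some (some (Sum.inl c))}
      {x | x = some none ∨ ∃ e, x = some (some (Sum.inr e))}).Adj x y ↔
      ExtAdj π K₀ false false x y := by
  simp only [splitInverse, SimpleGraph.fromRel_adj, extGraph_adj]
  rcases x with _ | _ | x | x <;> rcases y with _ | _ | y | y <;>
    simp [ExtAdj]

end ExtendedStars

theorem S3_eq_starGraphWithVertex (p q₁ q₂ : ℕ) :
    S3 p q₁ q₂ = starGraphWithVertex leafCenter {x | x.1 = 0} := by
  refine congrArg SimpleGraph.fromRel (funext fun x => funext fun y => ?_)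
  rcases x with _ | x | x <;> rcases y with _ | y | y <;> rfl

theorem S4_eq_extGraph (p q : ℕ) : S4 p q = extGraph leafCenter {x | x.1 = 0} := by
  refine congrArg SimpleGraph.fromRel (funext fun x => funext fun y => ?_)
  rcases x with _ | _ | x <;> rcases y with _ | _ | y <;>
    first
    | rfl
    | exact congrArg (fun G : SimpleGraph _ => G.Adj _ _) (S3_eq_starGraphWithVertex _ _ _)

theorem S4_adj_iff (p q : ℕ) (x y) :
    (S4 p q).Adj x y ↔ ExtAdj leafCenter {x | x.1 = 0} true false x y := by
  rw [S4_eq_extGraph]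
  exact extGraph_adj leafCenter {x | x.1 = 0} x y

theorem splitInverse_S4_adj_iff (p q : ℕ) (x y) :
    (splitInverse (S4 p q) (S4A p q) (S4B p q)).Adj x y ↔
      ExtAdj leafCenter {x | x.1 = 0} false false x y := by
  rw [S4_eq_extGraph]
  exact splitInverse_extGraph_adj leafCenter {x | x.1 = 0} x y

theorem compl_S4_adj_iff (p q : ℕ) (x y) :
    (S4 p q)ᶜ.Adj x y ↔ ExtAdj leafCenter {x | x.1 = 0} false true x y := by
  rw [SimpleGraph.compl_adj, S4_adj_iff]
  exact ExtAdj.compl_iff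

theorem compl_splitInverse_S4_adj_iff (p q : ℕ) (x y) :
    (splitInverse (S4 p q) (S4A p q) (S4B p q))ᶜ.Adj x y ↔
      ExtAdj leafCenter {x | x.1 = 0} true true x y := by
  rw [SimpleGraph.compl_adj, splitInverse_S4_adj_iff]
  exact ExtAdj.compl_iff

theorem splitCliqueWidth_le_extWidth {p q : ℕ} {a c : Bool}
    {G : SimpleGraph (Option (Option (S2Verts 2 ![p, p + 1] ![2, q])))}
    (hG : ∀ x y, G.Adj x y ↔ ExtAdj leafCenter {x | x.1 = 0} a c x y) :
    splitCliqueWidth G (if a then S4A p q else S4B p q) (if a then S4B p q else S4A p q) ≤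
      extWidth c := by
  have hb := (buildable_extAdj (π := leafCenter (t := 2) (p := ![p, p + 1]) (q := ![2, q]))
    (K₀ := {x | x.1 = 0}) (a := a) (c := c)).congr (R' := G.Adj)
    (fun x _ y _ => (hG x y).symm) (fun _ _ => rfl)
  refine splitCliqueWidth_le_of_buildable hb ?_ ?_
  · cases a <;> rintro x (rfl | ⟨z, rfl⟩) <;> rfl
  · cases a <;> rintro x (rfl | ⟨z, rfl⟩) <;> rfl

theorem stmt19 (p q : ℕ) (hp : 1 ≤ p) (hq : 1 ≤ q) :
    splitCliqueWidth (S4 p q) (S4A p q) (S4B p q) ≤ 4 ∧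
    splitCliqueWidth (splitInverse (S4 p q) (S4A p q) (S4B p q))
      (S4B p q) (S4A p q) ≤ 4 ∧
    splitCliqueWidth (S4 p q)ᶜ (S4B p q) (S4A p q) ≤ 5 ∧
    splitCliqueWidth (splitInverse (S4 p q) (S4A p q) (S4B p q))ᶜ
      (S4A p q) (S4B p q) ≤ 5 :=
  ⟨splitCliqueWidth_le_extWidth (S4_adj_iff p q),
    splitCliqueWidth_le_extWidth (splitInverse_S4_adj_iff p q),
    splitCliqueWidth_le_extWidth (compl_S4_adj_iff p q),
    splitCliqueWidth_le_extWidth (compl_splitInverse_S4_adj_iff p q)⟩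

end CWPaper
end
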